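/- arXiv:1711.01390 — 2 statements merged into one kernel-verified Lean document; each statement's English description precedes it below -/
import Mathlib

section
/- Let n ≥ 3, I = [0,1]^{n-1}, l = max(⌊(n-1)/2⌋+5, n+1), and f ∈ C^l(I) with 0 < c₁ ≤ |det ∇²f(x)| ≤ c₂ on I. Let ψ : ℕ → ℝ⁺ be decreasing and s > (n-1)/2. Define Ω_n(f,ψ) as the set of x ∈ I such that the system |x_i − a_i/q| < ψ(q)/q (1 ≤ i ≤ n−1) and |f(x) − b/q| < ψ(q)/q holds for infinitely many (q, a, b) ∈ ℕ × ℤ^{n-1} × ℤ. If Σ_{q=1}^∞ ψ(q)^{s+1} q^{n-1-s} < ∞, then H^s(Ω_n(f,ψ)) = 0. -/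
open MeasureTheory

/-- Hessian matrix of `f` at `x`. -/
noncomputable def hess {m : ℕ} (f : (Fin m → ℝ) → ℝ) (x : Fin m → ℝ) :
    Matrix (Fin m) (Fin m) ℝ :=
  Matrix.of fun i j => fderiv ℝ (fun y => fderiv ℝ f y (Pi.single j 1)) x (Pi.single i 1)

/-- `Ω_n(f,ψ)`: the set of `x ∈ I = [0,1]^{n-1}` such that the system
`|x_i − a_i/q| < ψ(q)/q` and `|f(x) − b/q| < ψ(q)/q` holds for infinitely many
`(q, a, b) ∈ ℕ × ℤ^{n-1} × ℤ`. -/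
def Omega (n : ℕ) (f : (Fin (n - 1) → ℝ) → ℝ) (ψ : ℕ → ℝ) : Set (Fin (n - 1) → ℝ) :=
  {x | x ∈ Set.Icc (0 : Fin (n - 1) → ℝ) 1 ∧
    {t : ℕ × (Fin (n - 1) → ℤ) × ℤ | 1 ≤ t.1 ∧
      (∀ i, |x i - (t.2.1 i : ℝ) / (t.1 : ℝ)| < ψ t.1 / (t.1 : ℝ)) ∧
      |f x - (t.2.2 : ℝ) / (t.1 : ℝ)| < ψ t.1 / (t.1 : ℝ)}.Infinite}

/-- Integer points `(q, a, b)`. -/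
abbrev IntTriple (m : ℕ) := ℤ × (Fin m → ℤ) × ℤ

/-- The real space containing a lattice of integer triples. -/
abbrev RealTriple (m : ℕ) := ℝ × (Fin m → ℝ) × ℝ

/-- The embedding of integer triples in real triples. -/
def IntTriple.toReal {m : ℕ} (w : IntTriple m) : RealTriple m :=
  ((w.1 : ℝ), fun i => (w.2.1 i : ℝ), (w.2.2 : ℝ))

/-- The bilinear pairing which crosses the first and the last coordinates. -/
def pairing {m : ℕ} (z : IntTriple m) (ξ : RealTriple m) : ℝ :=
  z.1 * ξ.2.2 + ∑ i, z.2.1 i * ξ.2.1 i + z.2.2 * ξ.1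

/-- The character `ξ ↦ exp (2πi ⟨z, ξ⟩)`. -/
noncomputable def character {m : ℕ} (z : IntTriple m) (ξ : RealTriple m) : ℂ :=
  Complex.exp ((2 * Real.pi * pairing z ξ : ℝ) * Complex.I)

/-- The half-open unit cube. -/
def unitCube (m : ℕ) : Set (RealTriple m) :=
  Set.Ico 0 1 ×ˢ (Set.univ.pi fun _ => Set.Ico 0 1) ×ˢ Set.Ico 0 1

lemma measurableSet_unitCube (m : ℕ) : MeasurableSet (unitCube m) :=
  measurableSet_Ico.prod ((MeasurableSet.univ_pi fun _ => measurableSet_Ico).prod measurableSet_Ico)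

lemma continuous_pairing {m : ℕ} (z : IntTriple m) : Continuous (pairing z) := by
  unfold pairing; fun_prop

lemma continuous_character {m : ℕ} (z : IntTriple m) : Continuous (character z) := by
  have := continuous_pairing z
  unfold character; fun_prop

lemma pairing_toReal_add {m : ℕ} (z w : IntTriple m) (ξ : RealTriple m) :
    pairing z (ξ + w.toReal) =
      pairing z ξ + ((z.1 * w.2.2 + ∑ i, z.2.1 i * w.2.1 i + z.2.2 * w.1 : ℤ) : ℝ) := by
  simp only [pairing, IntTriple.toReal, Prod.fst_add, Prod.snd_add, Pi.add_apply, mul_add,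
    Finset.sum_add_distrib]
  push_cast
  ring

lemma character_add_toReal {m : ℕ} (z w : IntTriple m) (ξ : RealTriple m) :
    character z (ξ + w.toReal) = character z ξ := by
  rw [character, pairing_toReal_add, character]
  rw [Complex.exp_eq_exp_iff_exists_int]
  refine ⟨z.1 * w.2.2 + ∑ i, z.2.1 i * w.2.1 i + z.2.2 * w.1, ?_⟩
  push_cast
  ring

lemma character_mul_conj {m : ℕ} (z z' : IntTriple m) (ξ : RealTriple m) :
    character z ξ * starRingEnd ℂ (character z' ξ) = character (z - z') ξ := by
  have : pairing (z - z') ξ = pairing z ξ - pairing z' ξ := by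
    simp [pairing, sub_mul, Finset.sum_sub_distrib]; ring
  simp only [character, this, ← Complex.exp_conj, ← Complex.exp_add]
  congr 1
  rw [map_mul, Complex.conj_ofReal, Complex.conj_I]
  push_cast
  ring

lemma integral_Ico_exp_int (k : ℤ) :
    ∫ x in Set.Ico (0 : ℝ) 1, Complex.exp ((2 * Real.pi * (k * x) : ℝ) * Complex.I) =
      if k = 0 then 1 else 0 := by
  rw [integral_Ico_eq_integral_Ioc, ← intervalIntegral.integral_of_le zero_le_one]
  split_ifs with h
  · simp [h]
  · have hc : (2 * Real.pi * k * Complex.I : ℂ) ≠ 0 := by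
      simp [Real.pi_ne_zero, h]
    have := integral_exp_mul_complex (a := 0) (b := 1) hc
    have h1 : Complex.exp (2 * Real.pi * k * Complex.I) = 1 := by
      rw [Complex.exp_eq_one_iff]; exact ⟨k, by ring⟩
    calc _ = ∫ x in (0 : ℝ)..1, Complex.exp ((2 * Real.pi * k * Complex.I : ℂ) * x) := by
          congr 1; ext x; congr 1; push_cast; ring
      _ = 0 := by rw [this]; simp [h1]

lemma integral_character {m : ℕ} (z : IntTriple m) :
    ∫ ξ in unitCube m, character z ξ = if z = 0 then 1 else 0 := by
  have hvol : (volume : Measure (RealTriple m)).restrict (unitCube m) =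
      (volume.restrict (Set.Ico 0 1)).prod
        ((Measure.pi fun _ => volume.restrict (Set.Ico 0 1)).prod
          (volume.restrict (Set.Ico 0 1))) := by
    rw [← Measure.restrict_pi_pi, Measure.prod_restrict, Measure.prod_restrict]
    rfl
  set e : ℤ → ℝ → ℂ := fun k x => Complex.exp ((2 * Real.pi * (k * x) : ℝ) * Complex.I) with he
  have hchar : ∀ ξ : RealTriple m, character z ξ =
      e z.2.2 ξ.1 * ((∏ i, e (z.2.1 i) (ξ.2.1 i)) * e z.1 ξ.2.2) := by
    intro ξ
    simp only [character, he, pairing, ← Complex.exp_sum, ← Complex.exp_add]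
    congr 1
    rw [← Finset.sum_mul]
    push_cast
    rw [← Finset.mul_sum]
    ring
  simp_rw [hvol, hchar]
  rw [integral_prod_mul (e z.2.2)
    (fun p : (Fin m → ℝ) × ℝ => (∏ i, e (z.2.1 i) (p.1 i)) * e z.1 p.2),
    integral_prod_mul (fun p : Fin m → ℝ => ∏ i, e (z.2.1 i) (p i)) (e z.1),
    integral_fintype_prod_eq_prod (fun i => e (z.2.1 i))]
  simp only [he, integral_Ico_exp_int]
  split_ifs with h1 h2 h3 h3 <;> simp_all [Prod.ext_iff, funext_iff, Finset.prod_eq_zero_iff]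

lemma lintegral_unitCube_sum_character {m : ℕ} (A : Finset (IntTriple m)) :
    ∫⁻ ξ in unitCube m, ENNReal.ofReal (‖∑ z ∈ A, character z ξ‖ ^ 2) = A.card := by
  have hfin : volume (unitCube m) ≠ ⊤ := by
    simp only [unitCube, Measure.volume_eq_prod, Measure.prod_prod, volume_pi_pi]
    simp
  have hchar : ∀ z, IntegrableOn (character (m := m) z) (unitCube m) := by
    intro z
    refine Integrable.mono' (g := fun _ => 1)
      ((integrableOn_const_iff (C := (1 : ℝ))).2 (Or.inr hfin.lt_top))
      (continuous_character z).aestronglyMeasurable (Filter.Eventually.of_forall fun ξ => ?_)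
    rw [character, Complex.norm_exp_ofReal_mul_I]
  have hsq : ∀ ξ : RealTriple m, ((‖∑ z ∈ A, character z ξ‖ ^ 2 : ℝ) : ℂ) =
      ∑ z ∈ A, ∑ z' ∈ A, character (z - z') ξ := by
    intro ξ
    rw [Complex.ofReal_pow, ← Complex.mul_conj', map_sum, Finset.sum_mul_sum]
    simp_rw [character_mul_conj]
  have hI : ∫ ξ in unitCube m, ((‖∑ z ∈ A, character z ξ‖ ^ 2 : ℝ) : ℂ) = A.card := by
    simp_rw [hsq]
    rw [integral_finsetSum _ fun z _ => integrable_finsetSum _ fun z' _ => hchar _]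
    simp_rw [integral_finsetSum A fun z' _ => hchar _, integral_character, sub_eq_zero]
    simp
  have hsq_int : IntegrableOn (fun ξ : RealTriple m => ‖∑ z ∈ A, character z ξ‖ ^ 2)
      (unitCube m) := by
    have : IntegrableOn (fun ξ : RealTriple m => ((‖∑ z ∈ A, character z ξ‖ ^ 2 : ℝ) : ℂ))
      (unitCube m) := by
      simp_rw [hsq]
      exact integrable_finsetSum _ fun z _ => integrable_finsetSum _ fun z' _ => hchar _
    exact this.re
  rw [← ofReal_integral_eq_lintegral_ofReal hsq_int
    (Filter.Eventually.of_forall fun ξ => by positivity)]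
  rw [integral_complex_ofReal] at hI
  have : ∫ ξ in unitCube m, ‖∑ z ∈ A, character z ξ‖ ^ 2 = A.card := by exact_mod_cast hI
  rw [this]; simp

lemma exists_toReal_add_mem_unitCube {m : ℕ} (ξ : RealTriple m) :
    ∃ w : IntTriple m, ξ + w.toReal ∈ unitCube m := by
  refine ⟨(-⌊ξ.1⌋, fun i => -⌊ξ.2.1 i⌋, -⌊ξ.2.2⌋), ?_⟩
  have h : ∀ x : ℝ, x + ((-⌊x⌋ : ℤ) : ℝ) ∈ Set.Ico (0 : ℝ) 1 := fun x => by
    rw [Int.cast_neg, ← sub_eq_add_neg]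
    exact ⟨Int.fract_nonneg x, Int.fract_lt_one x⟩
  exact ⟨h _, fun i _ => h _, h _⟩

lemma setLIntegral_le_of_periodic {m : ℕ} {B : Set (RealTriple m)} (hB : MeasurableSet B)
    (D : Finset (IntTriple m))
    (hD : ∀ ξ ∈ B, ∀ w : IntTriple m, ξ + w.toReal ∈ B → w ∈ D)
    {g : RealTriple m → ENNReal} (hg : Measurable g)
    (hper : ∀ (w : IntTriple m) ξ, g (ξ + w.toReal) = g ξ) :
    ∫⁻ ξ in B, g ξ ≤ D.card * ∫⁻ ξ in unitCube m, g ξ := by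
  have hcube := measurableSet_unitCube m
  have : (volume : Measure (RealTriple m)).IsAddLeftInvariant :=
    Measure.prod.instIsAddLeftInvariant (μ := (volume : Measure ℝ))
      (ν := (volume : Measure (Fin m → ℝ)).prod (volume : Measure ℝ))
  calc ∫⁻ ξ in B, g ξ = ∫⁻ ξ, B.indicator g ξ := (lintegral_indicator hB g).symm
    _ ≤ ∫⁻ ξ, ∑' w : IntTriple m,
          (unitCube m).indicator (fun η => B.indicator g (η - w.toReal)) (ξ + w.toReal) := by
        refine lintegral_mono fun ξ => ?_
        obtain ⟨w, hw⟩ := exists_toReal_add_mem_unitCube ξ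
        refine le_trans ?_ (ENNReal.le_tsum w)
        simp [Set.indicator_of_mem hw]
    _ = ∑' w : IntTriple m, ∫⁻ ξ,
          (unitCube m).indicator (fun η => B.indicator g (η - w.toReal)) (ξ + w.toReal) := by
        refine lintegral_tsum fun w => Measurable.aemeasurable ?_
        exact (((hg.indicator hB).comp (measurable_id.sub_const _)).indicator hcube).comp
          (measurable_id.add_const _)
    _ = ∑' w : IntTriple m, ∫⁻ ξ in unitCube m, B.indicator g (ξ - w.toReal) := by
        congr 1; ext w
        rw [lintegral_add_right_eq_self
          (fun ξ => (unitCube m).indicator (fun η => B.indicator g (η - w.toReal)) ξ),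
          lintegral_indicator hcube]
    _ = ∫⁻ ξ in unitCube m, ∑' w : IntTriple m, B.indicator g (ξ - w.toReal) := by
        refine (lintegral_tsum fun w => Measurable.aemeasurable ?_).symm
        exact (hg.indicator hB).comp (measurable_id.sub_const _)
    _ ≤ ∫⁻ ξ in unitCube m, D.card * g ξ := by
        refine lintegral_mono fun ξ => ?_
        have hgs : ∀ w : IntTriple m, g (ξ - w.toReal) = g ξ := fun w => by
          rw [← hper w, sub_add_cancel]
        by_cases hne : ∃ w₀ : IntTriple m, ξ - w₀.toReal ∈ B
        · obtain ⟨w₀, hw₀⟩ := hne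
          have hzero : ∀ w ∉ D.image (fun w => w₀ - w), B.indicator g (ξ - w.toReal) = 0 := by
            intro w hw
            refine Set.indicator_of_notMem (fun hmem => hw ?_) _
            refine Finset.mem_image.2 ⟨w₀ - w, hD _ hw₀ _ ?_, by abel⟩
            convert hmem using 1
            have : (w₀ - w).toReal = w₀.toReal - w.toReal := by
              ext <;> simp [IntTriple.toReal]
            rw [this]; abel
          rw [tsum_eq_sum hzero]
          calc _ ≤ ∑ _w ∈ D.image (fun w => w₀ - w), g ξ :=
                Finset.sum_le_sum fun w _ => (Set.indicator_le_self _ _ _).trans (hgs w).le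
            _ ≤ D.card * g ξ := by
                rw [Finset.sum_const, nsmul_eq_mul]
                refine mul_le_mul_left (Nat.cast_le.2 Finset.card_image_le) _
        · push Not at hne
          simp [Set.indicator_of_notMem (hne _)]
    _ = _ := lintegral_const_mul _ hg

/-- A large-sieve form of the duality between the lattice points of a convex body and those of
its polar body. -/
lemma card_mul_volume_le {m : ℕ} (A D : Finset (IntTriple m)) {B : Set (RealTriple m)}
    (hB : MeasurableSet B) (hAB : ∀ z ∈ A, ∀ ξ ∈ B, |pairing z ξ| ≤ 1 / 6)
    (hD : ∀ ξ ∈ B, ∀ w : IntTriple m, ξ + w.toReal ∈ B → w ∈ D) :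
    A.card * volume B ≤ 4 * D.card := by
  rcases A.eq_empty_or_nonempty with rfl | hA
  · simp
  have hcont : Continuous fun ξ : RealTriple m => ‖∑ z ∈ A, character z ξ‖ ^ 2 := by
    have := fun z => continuous_character (m := m) z
    fun_prop
  have hlow : ∀ ξ ∈ B, ENNReal.ofReal ((A.card / 2 : ℝ) ^ 2) ≤
      ENNReal.ofReal (‖∑ z ∈ A, character z ξ‖ ^ 2) := by
    intro ξ hξ
    refine ENNReal.ofReal_le_ofReal (pow_le_pow_left₀ (by positivity) ?_ 2)
    refine le_trans ?_ (Complex.re_le_norm _)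
    rw [Complex.re_sum, div_eq_mul_one_div, ← nsmul_eq_mul, ← Finset.sum_const]
    refine Finset.sum_le_sum fun z hz => ?_
    rw [character, Complex.exp_ofReal_mul_I_re, ← Real.cos_abs, ← Real.cos_pi_div_three]
    have h6 := hAB z hz ξ hξ
    refine Real.cos_le_cos_of_nonneg_of_le_pi (abs_nonneg _) (by linarith [Real.pi_pos]) ?_
    rw [abs_mul, abs_of_pos Real.two_pi_pos]
    nlinarith [Real.pi_pos]
  have hmain : ENNReal.ofReal ((A.card / 2 : ℝ) ^ 2) * volume B ≤ D.card * A.card := by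
    calc _ = ∫⁻ _ in B, ENNReal.ofReal ((A.card / 2 : ℝ) ^ 2) := by rw [setLIntegral_const]
      _ ≤ ∫⁻ ξ in B, ENNReal.ofReal (‖∑ z ∈ A, character z ξ‖ ^ 2) :=
          setLIntegral_mono hcont.measurable.ennreal_ofReal hlow
      _ ≤ _ := by
          rw [← lintegral_unitCube_sum_character A]
          refine setLIntegral_le_of_periodic hB D hD hcont.measurable.ennreal_ofReal fun w ξ => ?_
          simp_rw [character_add_toReal]
  have hA0 : (A.card : ENNReal) ≠ 0 := by simpa using hA.ne_empty
  have hsq : (A.card : ENNReal) * A.card = 4 * ENNReal.ofReal ((A.card / 2 : ℝ) ^ 2) := by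
    rw [show (4 : ENNReal) = ENNReal.ofReal 4 by simp, ← ENNReal.ofReal_mul (by norm_num),
      ← ENNReal.ofReal_natCast, ← ENNReal.ofReal_mul (by positivity)]
    congr 1; ring
  rw [← ENNReal.mul_le_mul_iff_right hA0 (ENNReal.natCast_ne_top _)]
  calc _ = 4 * (ENNReal.ofReal ((A.card / 2 : ℝ) ^ 2) * volume B) := by
        rw [← mul_assoc, hsq, mul_assoc]
    _ ≤ 4 * (D.card * A.card) := by gcongr
    _ = _ := by ring

/-- A box in the linear coordinates adapted to the point `(x, u)` of a hypersurface with
gradient `y`. -/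
def shearBox {m : ℕ} (x y : Fin m → ℝ) (u h₁ h₂ h₃ : ℝ) : Set (RealTriple m) :=
  {ξ | |ξ.1| ≤ h₁ ∧ (∀ i, |ξ.2.1 i + ξ.1 * y i| ≤ h₂) ∧
    |ξ.2.2 + ∑ i, ξ.2.1 i * x i + ξ.1 * u| ≤ h₃}

lemma measurableSet_shearBox {m : ℕ} (x y : Fin m → ℝ) (u h₁ h₂ h₃ : ℝ) :
    MeasurableSet (shearBox x y u h₁ h₂ h₃) := by
  simp only [shearBox, Set.ofPred_and, Set.ofPred_forall]
  refine IsClosed.measurableSet (IsClosed.inter ?_ (IsClosed.inter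
    (isClosed_iInter fun i => ?_) ?_)) <;>
  exact isClosed_le (by fun_prop) (by fun_prop)

lemma volume_shearBox {m : ℕ} (x y : Fin m → ℝ) (u : ℝ) {h₁ h₂ h₃ : ℝ}
    (hh₁ : 0 ≤ h₁) (hh₂ : 0 ≤ h₂) :
    volume (shearBox x y u h₁ h₂ h₃) =
      ENNReal.ofReal ((2 * h₁) * ((2 * h₂) ^ m * (2 * h₃))) := by
  have hshear : MeasurePreserving (fun ξ : RealTriple m =>
      ((ξ.1, (fun i => ξ.2.1 i + ξ.1 * y i), ξ.2.2 + (∑ i, ξ.2.1 i * x i + ξ.1 * u)) :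
        RealTriple m)) := by
    refine MeasurePreserving.skew_product (μa := (volume : Measure ℝ)) (μb := volume)
      (μc := (volume : Measure (Fin m → ℝ)).prod (volume : Measure ℝ))
      (μd := (volume : Measure (Fin m → ℝ)).prod (volume : Measure ℝ)) (f := id)
      (g := fun d p => (fun i => p.1 i + d * y i, p.2 + (∑ i, p.1 i * x i + d * u)))
      (MeasurePreserving.id _) (Continuous.measurable ?_)
      (Filter.Eventually.of_forall fun d => ?_)
    · simp only [Function.uncurry_def]; fun_prop
    · refine MeasurePreserving.map_eq (MeasurePreserving.skew_product
        (f := fun c : Fin m → ℝ => fun i => c i + d * y i)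
        (g := fun c c₀ => c₀ + (∑ i, c i * x i + d * u)) ?_ ?_ ?_)
      · exact measurePreserving_add_right volume (fun i => d * y i)
      · apply Continuous.measurable
        simp only [Function.uncurry_def]; fun_prop
      · exact Filter.Eventually.of_forall fun c =>
          (measurePreserving_add_right volume (∑ i, c i * x i + d * u)).map_eq
  set S : Set (RealTriple m) :=
    Set.Icc (-h₁) h₁ ×ˢ (Set.univ.pi fun _ => Set.Icc (-h₂) h₂) ×ˢ Set.Icc (-h₃) h₃ with hS
  have hSm : MeasurableSet S := measurableSet_Icc.prod
    ((MeasurableSet.univ_pi fun _ => measurableSet_Icc).prod measurableSet_Icc)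
  have hpre : shearBox x y u h₁ h₂ h₃ = (fun ξ : RealTriple m =>
      ((ξ.1, (fun i => ξ.2.1 i + ξ.1 * y i), ξ.2.2 + (∑ i, ξ.2.1 i * x i + ξ.1 * u)) :
        RealTriple m)) ⁻¹' S := by
    ext ξ
    simp only [shearBox, hS, Set.mem_ofPred_eq, Set.mem_preimage, Set.mem_prod, Set.mem_pi,
      Set.mem_univ, true_imp_iff, Set.mem_Icc, abs_le, add_assoc]
  rw [hpre, hshear.measure_preimage hSm.nullMeasurableSet, hS]
  simp only [Measure.volume_eq_prod, Measure.prod_prod, volume_pi_pi, Real.volume_Icc,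
    Finset.prod_const, Finset.card_univ, Fintype.card_fin]
  rw [ENNReal.ofReal_mul (p := 2 * h₁) (by positivity),
    ENNReal.ofReal_mul (p := (2 * h₂) ^ m) (by positivity), ENNReal.ofReal_pow (by positivity)]
  congr 3 <;> ring_nf

/-- Points of a sheared box are controlled by the points of the dual box. -/
lemma card_mul_le_card_dual {m : ℕ} (x y : Fin m → ℝ) (u : ℝ) {Q δ R κ F : ℝ} (hQ : 0 < Q)
    (hδ : 0 < δ) (hR : 0 < R) (hκ : 0 < κ) (hF : κ * (2 + 4 * m + F) ≤ 1 / 6)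
    (A D : Finset (IntTriple m))
    (hA : ∀ z ∈ A, |(z.1 : ℝ)| ≤ 2 * Q ∧ (∀ i, |(z.2.1 i : ℝ) - z.1 * x i| ≤ 4 * R) ∧
      |(z.2.2 : ℝ) - z.1 * u - ∑ i, y i * (z.2.1 i - z.1 * x i)| ≤ F * δ)
    (hD : ∀ w : IntTriple m, w.toReal ∈ shearBox x y u (2 * κ / δ) (2 * κ / R) (2 * κ / Q) →
      w ∈ D) :
    A.card * ((2 * κ / δ) * ((2 * κ / R) ^ m * (2 * κ / Q))) ≤ 4 * D.card := by
  have key := card_mul_volume_le A D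
    (measurableSet_shearBox x y u (κ / δ) (κ / R) (κ / Q)) ?_ ?_
  · rw [volume_shearBox x y u (by positivity) (by positivity)] at key
    have h4 : (4 : ENNReal) * D.card = ENNReal.ofReal (4 * D.card) := by
      rw [ENNReal.ofReal_mul (by norm_num)]; simp
    rw [h4, ← ENNReal.ofReal_natCast, ← ENNReal.ofReal_mul (by positivity),
      ENNReal.ofReal_le_ofReal_iff (by positivity)] at key
    simpa only [mul_div_assoc] using key
  · rintro z hz ξ ⟨h1, h2, h3⟩
    obtain ⟨g1, g2, g3⟩ := hA z hz
    have hid : pairing z ξ = z.1 * (ξ.2.2 + ∑ i, ξ.2.1 i * x i + ξ.1 * u) +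
        ∑ i, (z.2.1 i - z.1 * x i) * (ξ.2.1 i + ξ.1 * y i) +
        ((z.2.2 : ℝ) - z.1 * u - ∑ i, y i * (z.2.1 i - z.1 * x i)) * ξ.1 := by
      have e : ∑ i, ((z.2.1 i : ℝ) - z.1 * x i) * (ξ.2.1 i + ξ.1 * y i) =
          ∑ i, z.2.1 i * ξ.2.1 i - z.1 * ∑ i, ξ.2.1 i * x i +
            (∑ i, y i * (z.2.1 i - z.1 * x i)) * ξ.1 := by
        rw [Finset.mul_sum, Finset.sum_mul, ← Finset.sum_sub_distrib, ← Finset.sum_add_distrib]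
        refine Finset.sum_congr rfl fun i _ => ?_
        ring
      rw [e, pairing]; ring
    rw [hid]
    have b1 : |(z.1 : ℝ) * (ξ.2.2 + ∑ i, ξ.2.1 i * x i + ξ.1 * u)| ≤ 2 * κ := by
      rw [abs_mul]
      calc _ ≤ 2 * Q * (κ / Q) := by gcongr
        _ = 2 * κ := by field_simp
    have b2 : |∑ i, ((z.2.1 i : ℝ) - z.1 * x i) * (ξ.2.1 i + ξ.1 * y i)| ≤ m * (4 * κ) := by
      refine (Finset.abs_sum_le_sum_abs _ _).trans ?_
      calc _ ≤ ∑ _i : Fin m, 4 * κ := by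
            refine Finset.sum_le_sum fun i _ => ?_
            rw [abs_mul]
            calc _ ≤ 4 * R * (κ / R) := by gcongr; exacts [g2 i, h2 i]
              _ = 4 * κ := by field_simp
        _ = _ := by simp
    have b3 : |((z.2.2 : ℝ) - z.1 * u - ∑ i, y i * (z.2.1 i - z.1 * x i)) * ξ.1| ≤ F * κ := by
      rw [abs_mul]
      calc _ ≤ F * δ * (κ / δ) :=
            mul_le_mul g3 h1 (abs_nonneg _) ((abs_nonneg _).trans g3)
        _ = F * κ := by field_simp
    calc _ ≤ 2 * κ + m * (4 * κ) + F * κ :=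
          (abs_add_le _ _).trans (add_le_add ((abs_add_le _ _).trans (add_le_add b1 b2)) b3)
      _ = κ * (2 + 4 * m + F) := by ring
      _ ≤ _ := hF
  · rintro ξ ⟨h1, h2, h3⟩ w ⟨g1, g2, g3⟩
    have hdouble : ∀ {p q r s : ℝ}, |p| ≤ s → |q| ≤ s → r = q - p → |r| ≤ 2 * s := by
      rintro p q r s hp hq rfl
      linarith [abs_sub q p]
    refine hD w ⟨?_, fun i => ?_, ?_⟩ <;> rw [mul_div_assoc]
    · exact hdouble h1 g1 (by simp)
    · exact hdouble (h2 i) (g2 i) (by simp; ring)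
    · refine hdouble h3 g3 ?_
      simp only [Prod.fst_add, Prod.snd_add, Pi.add_apply, add_mul, Finset.sum_add_distrib]
      ring

/-- A hypersurface with points `(x t, u t)` and gradients `y t`, together with quantitative
nondegeneracy. This class is stable under the Legendre transform. -/
structure LegendrePair {ι : Type*} {m : ℕ} (x y : ι → Fin m → ℝ) (u : ι → ℝ) (C : ℝ) :
    Prop where
  one_le : 1 ≤ C
  abs_x_le : ∀ t i, |x t i| ≤ C
  abs_y_le : ∀ t i, |y t i| ≤ C
  abs_u_le : ∀ t, |u t| ≤ C
  norm_x_sub_le : ∀ s t, ‖x s - x t‖ ≤ C * ‖y s - y t‖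
  norm_y_sub_le : ∀ s t, ‖y s - y t‖ ≤ C * ‖x s - x t‖
  taylor : ∀ s t, |u s - u t - ∑ i, y t i * (x s i - x t i)| ≤ C * ‖x s - x t‖ ^ 2

lemma abs_sum_mul_le {m : ℕ} {a b : Fin m → ℝ} {A B : ℝ} (ha : ∀ i, |a i| ≤ A)
    (hb : ∀ i, |b i| ≤ B) : |∑ i, a i * b i| ≤ m * (A * B) := by
  refine (Finset.abs_sum_le_sum_abs _ _).trans ?_
  calc _ ≤ ∑ _i : Fin m, A * B := by
        refine Finset.sum_le_sum fun i _ => ?_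
        rw [abs_mul]
        exact mul_le_mul (ha i) (hb i) (abs_nonneg _) ((abs_nonneg _).trans (ha i))
    _ = _ := by simp

lemma LegendrePair.dual {ι : Type*} {m : ℕ} {x y : ι → Fin m → ℝ} {u : ι → ℝ} {C : ℝ}
    (h : LegendrePair x y u C) :
    LegendrePair y x (fun t => ∑ i, x t i * y t i - u t) ((m + 1) * C ^ 3) := by
  have h1 := h.one_le
  have hC2 : C ≤ C ^ 2 := by nlinarith
  have hC3 : C ^ 2 ≤ C ^ 3 := by nlinarith [sq_nonneg C]
  have hm : (0 : ℝ) ≤ m := m.cast_nonneg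
  have hm3 : 0 ≤ m * C ^ 3 := by positivity
  have hCC : C ≤ (m + 1) * C ^ 3 := by linarith
  refine ⟨h1.trans hCC, fun t i => (h.abs_y_le t i).trans hCC,
    fun t i => (h.abs_x_le t i).trans hCC, fun t => ?_, fun s t => ?_, fun s t => ?_,
    fun s t => ?_⟩
  · have := abs_sum_mul_le (h.abs_x_le t) (h.abs_y_le t)
    have h3 : m * (C * C) ≤ m * C ^ 3 := by
      apply mul_le_mul_of_nonneg_left _ hm; nlinarith
    linarith [abs_sub (∑ i, x t i * y t i) (u t), h.abs_u_le t]
  · exact (h.norm_y_sub_le s t).trans (mul_le_mul_of_nonneg_right hCC (norm_nonneg _))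
  · exact (h.norm_x_sub_le s t).trans (mul_le_mul_of_nonneg_right hCC (norm_nonneg _))
  · have e : ∑ i, x s i * y s i - u s - (∑ i, x t i * y t i - u t) -
        ∑ i, x t i * (y s i - y t i) = u t - u s - ∑ i, y s i * (x t i - x s i) := by
      have : ∑ i, x s i * y s i - ∑ i, x t i * y t i - ∑ i, x t i * (y s i - y t i) =
          - ∑ i, y s i * (x t i - x s i) := by
        rw [← Finset.sum_sub_distrib, ← Finset.sum_sub_distrib, ← Finset.sum_neg_distrib]
        refine Finset.sum_congr rfl fun i _ => ?_
        ring
      linarith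
    rw [e]
    calc _ ≤ C * ‖x t - x s‖ ^ 2 := h.taylor t s
      _ ≤ C * (C * ‖y t - y s‖) ^ 2 := by gcongr; exact h.norm_x_sub_le t s
      _ = C ^ 3 * ‖y s - y t‖ ^ 2 := by rw [norm_sub_rev]; ring
      _ ≤ _ := by gcongr; linarith

/-- Integer points `(q, a, b)` with `q ∼ Q` for which `(a / q, b / q)` is within `δ / q` of a
tangent hyperplane, at a point of contact which is close to `a / q`. -/
def nearPoints {ι : Type*} {m : ℕ} (x y : ι → Fin m → ℝ) (u : ι → ℝ) (Q δ : ℝ) :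
    Set (IntTriple m) :=
  {z | Q ≤ z.1 ∧ z.1 ≤ 2 * Q ∧ ∃ t, (∀ i, ((z.2.1 i : ℝ) - z.1 * x t i) ^ 2 ≤ δ * z.1) ∧
    |(z.2.2 : ℝ) - z.1 * u t - ∑ i, y t i * (z.2.1 i - z.1 * x t i)| ≤ δ}

lemma nearPoints_mono {ι : Type*} {m : ℕ} (x y : ι → Fin m → ℝ) (u : ι → ℝ) {Q δ δ' : ℝ}
    (hQ : 1 ≤ Q) (hδ : δ ≤ δ') : nearPoints x y u Q δ ⊆ nearPoints x y u Q δ' := by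
  rintro z ⟨h1, h2, t, h3, h4⟩
  refine ⟨h1, h2, t, fun i => (h3 i).trans ?_, h4.trans hδ⟩
  have : (0 : ℝ) ≤ z.1 := by linarith
  gcongr

lemma card_Icc_ceil_floor_le {α ρ : ℝ} (hρ : 0 ≤ ρ) :
    ((Finset.Icc ⌈α - ρ⌉ ⌊α + ρ⌋).card : ℝ) ≤ 2 * ρ + 1 := by
  rw [Int.card_Icc]
  have h : ((⌊α + ρ⌋ + 1 - ⌈α - ρ⌉ : ℤ) : ℝ) ≤ 2 * ρ + 1 := by
    push_cast
    linarith [Int.floor_le (α + ρ), Int.le_ceil (α - ρ)]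
  rcases le_total 0 (⌊α + ρ⌋ + 1 - ⌈α - ρ⌉) with h0 | h0
  · have : (((⌊α + ρ⌋ + 1 - ⌈α - ρ⌉).toNat : ℤ) : ℝ) ≤ 2 * ρ + 1 := by
      rwa [Int.toNat_of_nonneg h0]
    exact_mod_cast this
  · rw [Int.toNat_of_nonpos h0]
    simp only [Nat.cast_zero]; positivity

lemma card_le_of_abs_sub_le {m : ℕ} (S : Finset (Fin m → ℤ)) (α : Fin m → ℝ) {ρ : ℝ}
    (hρ : 0 ≤ ρ) (h : ∀ c ∈ S, ∀ i, |(c i : ℝ) - α i| ≤ ρ) :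
    (S.card : ℝ) ≤ (2 * ρ + 1) ^ m := by
  have hsub : S ⊆ Fintype.piFinset fun i => Finset.Icc ⌈α i - ρ⌉ ⌊α i + ρ⌋ := by
    intro c hc
    refine Fintype.mem_piFinset.2 fun i => Finset.mem_Icc.2 ?_
    have := abs_le.1 (h c hc i)
    exact ⟨Int.ceil_le.2 (by linarith), Int.le_floor.2 (by linarith)⟩
  calc (S.card : ℝ) ≤ (Fintype.piFinset fun i => Finset.Icc ⌈α i - ρ⌉ ⌊α i + ρ⌋).card := by
        exact_mod_cast Finset.card_le_card hsub
    _ = ∏ i, ((Finset.Icc ⌈α i - ρ⌉ ⌊α i + ρ⌋).card : ℝ) := by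
        rw [Fintype.card_piFinset]; push_cast; rfl
    _ ≤ ∏ _i : Fin m, (2 * ρ + 1) :=
        Finset.prod_le_prod (fun _ _ => by positivity) fun i _ => card_Icc_ceil_floor_le hρ
    _ = _ := by simp

/-- The integer triples in a cube centred at the origin. -/
noncomputable def intBox (m : ℕ) (X : ℝ) : Finset (IntTriple m) :=
  Finset.Icc ⌈0 - X⌉ ⌊0 + X⌋ ×ˢ (Fintype.piFinset fun _ => Finset.Icc ⌈0 - X⌉ ⌊0 + X⌋) ×ˢ
    Finset.Icc ⌈0 - X⌉ ⌊0 + X⌋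

lemma card_intBox_le (m : ℕ) {X : ℝ} (hX : 0 ≤ X) :
    ((intBox m X).card : ℝ) ≤ (2 * X + 1) ^ (m + 2) := by
  have h := card_Icc_ceil_floor_le (α := 0) hX
  rw [intBox, Finset.card_product, Finset.card_product, Fintype.card_piFinset]
  push_cast
  rw [Finset.prod_const, Finset.card_univ, Fintype.card_fin]
  calc _ ≤ (2 * X + 1) * ((2 * X + 1) ^ m * (2 * X + 1)) := by gcongr
    _ = _ := by ring

lemma mem_intBox {m : ℕ} {X : ℝ} {z : IntTriple m} (h1 : |(z.1 : ℝ)| ≤ X)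
    (h2 : ∀ i, |(z.2.1 i : ℝ)| ≤ X) (h3 : |(z.2.2 : ℝ)| ≤ X) : z ∈ intBox m X := by
  have h : ∀ {k : ℤ}, |(k : ℝ)| ≤ X → k ∈ Finset.Icc ⌈0 - X⌉ ⌊0 + X⌋ := fun {k} hk => by
    have := abs_le.1 hk
    exact Finset.mem_Icc.2 ⟨Int.ceil_le.2 (by linarith), Int.le_floor.2 (by linarith)⟩
  simp only [intBox, Finset.mem_product, Fintype.mem_piFinset]
  exact ⟨h h1, fun i => h (h2 i), h h3⟩

lemma LegendrePair.nearPoints_subset_intBox {ι : Type*} {m : ℕ} {x y : ι → Fin m → ℝ}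
    {u : ι → ℝ} {C : ℝ} (h : LegendrePair x y u C) {Q δ : ℝ} (hQ : 1 ≤ Q) (hδ : δ ≤ 1) :
    nearPoints x y u Q δ ⊆ intBox m ((2 * m + 4) * C * Q) := by
  rintro z ⟨h1, h2, t, h3, h4⟩
  have hC := h.one_le
  have hq0 : (0 : ℝ) ≤ z.1 := by linarith
  have hCQ : Q ≤ C * Q := by nlinarith
  have hmCQ : 0 ≤ m * (C * Q) := by positivity
  have ha : ∀ i, |(z.2.1 i : ℝ) - z.1 * x t i| ≤ 2 * Q := fun i => by
    refine abs_le_of_sq_le_sq ((h3 i).trans ?_) (by linarith)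
    nlinarith
  have hqC : ∀ {w : ℝ}, |w| ≤ C → |z.1 * w| ≤ 2 * (C * Q) := fun {w} hw => by
    rw [abs_mul, abs_of_nonneg hq0]
    calc _ ≤ 2 * Q * C := by gcongr
      _ = _ := by ring
  refine mem_intBox ?_ (fun i => ?_) ?_
  · rw [abs_of_nonneg hq0]; nlinarith
  · have e : (z.2.1 i : ℝ) = (z.2.1 i - z.1 * x t i) + z.1 * x t i := by ring
    rw [e]
    have := abs_add_le ((z.2.1 i : ℝ) - z.1 * x t i) (z.1 * x t i)
    nlinarith [ha i, hqC (h.abs_x_le t i)]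
  · have e : (z.2.2 : ℝ) = (z.2.2 - z.1 * u t - ∑ i, y t i * (z.2.1 i - z.1 * x t i)) +
        z.1 * u t + ∑ i, y t i * (z.2.1 i - z.1 * x t i) := by ring
    rw [e]
    have h5 := abs_sum_mul_le (h.abs_y_le t) ha
    have h6 := hqC (h.abs_u_le t)
    calc _ ≤ δ + 2 * (C * Q) + m * (C * (2 * Q)) := (abs_add_le _ _).trans
          (add_le_add ((abs_add_le _ _).trans (add_le_add h4 h6)) h5)
      _ ≤ _ := by nlinarith

lemma LegendrePair.finite_nearPoints {ι : Type*} {m : ℕ} {x y : ι → Fin m → ℝ}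
    {u : ι → ℝ} {C : ℝ} (h : LegendrePair x y u C) {Q δ : ℝ} (hQ : 1 ≤ Q) (hδ : δ ≤ 1) :
    (nearPoints x y u Q δ).Finite :=
  (Finset.finite_toSet _).subset (h.nearPoints_subset_intBox hQ hδ)

/-- The counting estimate with exponent `β`, for all Legendre pairs. -/
def CountingBound (ι : Type*) (m : ℕ) (β : ℝ) : Prop :=
  ∀ (x y : ι → Fin m → ℝ) (u : ι → ℝ) (C : ℝ), LegendrePair x y u C →
    ∃ K : ℝ, 0 ≤ K ∧ ∀ Q δ : ℝ, 1 ≤ Q → 0 < δ → δ ≤ 1 →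
      ((nearPoints x y u Q δ).ncard : ℝ) ≤ K * (Q ^ (m + 1) * (δ + Q ^ (-β)))

lemma countingBound_neg_one (ι : Type*) (m : ℕ) : CountingBound ι m (-1) := by
  intro x y u C h
  have hC := h.one_le
  refine ⟨(3 * ((2 * m + 4) * C)) ^ (m + 2), by positivity, fun Q δ hQ hδ0 hδ => ?_⟩
  have hX : 1 ≤ (2 * m + 4) * C * Q := by
    have : 0 ≤ m * (C * Q) := by positivity
    nlinarith [mul_le_mul hC hQ zero_le_one (by linarith)]
  calc ((nearPoints x y u Q δ).ncard : ℝ) ≤ (intBox m ((2 * m + 4) * C * Q)).card := by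
        rw [← Set.ncard_coe_finset]
        exact_mod_cast Set.ncard_le_ncard (h.nearPoints_subset_intBox hQ hδ)
          (Finset.finite_toSet _)
    _ ≤ (2 * ((2 * m + 4) * C * Q) + 1) ^ (m + 2) := card_intBox_le m (by positivity)
    _ ≤ (3 * ((2 * m + 4) * C * Q)) ^ (m + 2) := by gcongr; linarith
    _ = (3 * ((2 * m + 4) * C)) ^ (m + 2) * (Q ^ (m + 1) * Q) := by
        rw [← pow_succ, ← mul_pow]; ring
    _ ≤ _ := by
        rw [neg_neg, Real.rpow_one]
        gcongr
        linarith

lemma LegendrePair.form_bounds_of_near {ι : Type*} {m : ℕ} {x y : ι → Fin m → ℝ}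
    {u : ι → ℝ} {C : ℝ} (h : LegendrePair x y u C) {Q r δ : ℝ} (hQ : 1 ≤ Q) (hr : 0 < r)
    (hδ : Q * r ^ 2 = δ) {z : IntTriple m} (hz1 : Q ≤ z.1) (hz2 : z.1 ≤ 2 * Q) {s t : ι}
    (hs : ∀ i, ((z.2.1 i : ℝ) - z.1 * x s i) ^ 2 ≤ δ * z.1)
    (hs' : |(z.2.2 : ℝ) - z.1 * u s - ∑ i, y s i * (z.2.1 i - z.1 * x s i)| ≤ δ)
    (hst : ∀ i, |x s i - x t i| ≤ r) :
    |(z.1 : ℝ)| ≤ 2 * Q ∧ (∀ i, |(z.2.1 i : ℝ) - z.1 * x t i| ≤ 4 * (Q * r)) ∧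
      |(z.2.2 : ℝ) - z.1 * u t - ∑ i, y t i * (z.2.1 i - z.1 * x t i)| ≤
        ((2 * m + 3) * C) * δ := by
  have hC := h.one_le
  have hq0 : (0 : ℝ) ≤ z.1 := by linarith
  have hδ0 : 0 < δ := by rw [← hδ]; positivity
  have ha : ∀ i, |(z.2.1 i : ℝ) - z.1 * x s i| ≤ 2 * (Q * r) := fun i => by
    refine abs_le_of_sq_le_sq ((hs i).trans ?_) (by positivity)
    calc δ * z.1 ≤ δ * (2 * Q) := by gcongr
      _ ≤ (2 * (Q * r)) ^ 2 := by rw [← hδ]; nlinarith [sq_nonneg (Q * r)]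
  have hnorm : ‖x s - x t‖ ≤ r := (pi_norm_le_iff_of_nonneg hr.le).2 hst
  refine ⟨by rwa [abs_of_nonneg hq0], fun i => ?_, ?_⟩
  · have e : (z.2.1 i : ℝ) - z.1 * x t i =
        (z.2.1 i - z.1 * x s i) + z.1 * (x s i - x t i) := by ring
    rw [e]
    have h2 : |(z.1 : ℝ) * (x s i - x t i)| ≤ 2 * Q * r := by
      rw [abs_mul, abs_of_nonneg hq0]
      exact mul_le_mul hz2 (hst i) (abs_nonneg _) (by positivity)
    linarith [abs_add_le ((z.2.1 i : ℝ) - z.1 * x s i) (z.1 * (x s i - x t i)), ha i]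
  · have e : (z.2.2 : ℝ) - z.1 * u t - ∑ i, y t i * (z.2.1 i - z.1 * x t i) =
        (z.2.2 - z.1 * u s - ∑ i, y s i * (z.2.1 i - z.1 * x s i)) +
        z.1 * (u s - u t - ∑ i, y t i * (x s i - x t i)) +
        ∑ i, (y s i - y t i) * (z.2.1 i - z.1 * x s i) := by
      have : ∑ i, y t i * ((z.2.1 i : ℝ) - z.1 * x t i) =
          ∑ i, y s i * (z.2.1 i - z.1 * x s i) + z.1 * ∑ i, y t i * (x s i - x t i) -
          ∑ i, (y s i - y t i) * (z.2.1 i - z.1 * x s i) := by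
        rw [Finset.mul_sum, ← Finset.sum_add_distrib, ← Finset.sum_sub_distrib]
        refine Finset.sum_congr rfl fun i _ => ?_
        ring
      rw [this]; ring
    rw [e]
    have b2 : |(z.1 : ℝ) * (u s - u t - ∑ i, y t i * (x s i - x t i))| ≤ 2 * C * δ := by
      rw [abs_mul, abs_of_nonneg hq0]
      calc _ ≤ 2 * Q * (C * r ^ 2) := by
            refine mul_le_mul hz2 ((h.taylor s t).trans ?_) (abs_nonneg _) (by positivity)
            gcongr
        _ = _ := by rw [← hδ]; ring
    have hy : ∀ i, |y s i - y t i| ≤ C * r := fun i =>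
      (norm_le_pi_norm (y s - y t) i).trans ((h.norm_y_sub_le s t).trans (by gcongr))
    have b3 := abs_sum_mul_le hy ha
    have b3' : m * (C * r * (2 * (Q * r))) = 2 * m * C * δ := by rw [← hδ]; ring
    have b1 : δ ≤ C * δ := by nlinarith
    calc _ ≤ δ + 2 * C * δ + m * (C * r * (2 * (Q * r))) := (abs_add_le _ _).trans
          (add_le_add ((abs_add_le _ _).trans (add_le_add hs' b2)) b3)
      _ ≤ _ := by rw [b3']; nlinarith

/-- Reflection in the middle coordinates. -/
def IntTriple.reflect {m : ℕ} (w : IntTriple m) : IntTriple m := (w.1, -w.2.1, w.2.2)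

@[simp] lemma IntTriple.reflect_reflect {m : ℕ} (w : IntTriple m) : w.reflect.reflect = w := by
  simp [IntTriple.reflect]

lemma reflect_mem_nearPoints {ι : Type*} {m : ℕ} {x y : ι → Fin m → ℝ} {u : ι → ℝ}
    {Q r δ κ : ℝ} (hQ : 1 ≤ Q) (hr : 0 < r) (hδ : Q * r ^ 2 = δ) (hκ : 2 * κ ≤ 1) {t : ι}
    {w : IntTriple m} (hw1 : 1 ≤ w.1)
    (hw : w.toReal ∈ shearBox (x t) (y t) (u t) (2 * κ / δ) (2 * κ / (Q * r)) (2 * κ / Q)) :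
    δ * 2 ^ Nat.log 2 w.1.toNat ≤ 1 ∧
      w.reflect ∈ nearPoints y x (fun t => ∑ i, x t i * y t i - u t)
        (2 ^ Nat.log 2 w.1.toNat) (1 / (δ * Q * 2 ^ Nat.log 2 w.1.toNat)) := by
  obtain ⟨h1, h2, h3⟩ := hw
  simp only [IntTriple.toReal] at h1 h2 h3
  have hQ0 : 0 < Q := by linarith
  have hδ0 : 0 < δ := by rw [← hδ]; positivity
  have hw1' : (1 : ℝ) ≤ w.1 := by exact_mod_cast hw1
  set d := w.1.toNat with hd
  have hdw : ((d : ℕ) : ℤ) = w.1 := Int.toNat_of_nonneg (by omega)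
  have hdw' : ((d : ℕ) : ℝ) = w.1 := by exact_mod_cast congrArg (Int.cast (R := ℝ)) hdw
  have hd0 : d ≠ 0 := by omega
  set P : ℝ := 2 ^ Nat.log 2 d with hP
  have hP1 : 1 ≤ P := one_le_pow₀ (by norm_num)
  have hPd : P ≤ w.1 := by
    rw [← hdw', hP]; exact_mod_cast Nat.pow_log_le_self 2 hd0
  have hdP : (w.1 : ℝ) ≤ 2 * P := by
    rw [← hdw', hP, ← pow_succ']
    exact_mod_cast (Nat.lt_pow_succ_log_self (by norm_num) d).le
  have hdδ : w.1 * δ ≤ 1 := by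
    rw [abs_of_nonneg (by linarith), le_div_iff₀ hδ0] at h1
    linarith
  have hPδ : δ * P ≤ 1 := by nlinarith
  refine ⟨hPδ, hPd, hdP, t, fun i => ?_, ?_⟩
  · have e : ((w.reflect.2.1 i : ℤ) : ℝ) - w.reflect.1 * y t i = -(w.2.1 i + w.1 * y t i) := by
      simp [IntTriple.reflect]; ring
    rw [e, neg_sq]
    have h2' : |(w.2.1 i : ℝ) + w.1 * y t i| ≤ 1 / (Q * r) :=
      (h2 i).trans (by gcongr)
    calc _ ≤ (1 / (Q * r)) ^ 2 := by
          rw [← sq_abs]; gcongr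
      _ = 1 / (δ * Q * P) * P := by rw [← hδ]; field_simp
      _ ≤ _ := by
          simp only [IntTriple.reflect]; gcongr
  · have e : ((w.reflect.2.2 : ℤ) : ℝ) - w.reflect.1 * (∑ i, x t i * y t i - u t) -
        ∑ i, x t i * ((w.reflect.2.1 i : ℤ) - w.reflect.1 * y t i) =
        w.2.2 + ∑ i, w.2.1 i * x t i + w.1 * u t := by
      have : ∑ i, x t i * (((w.reflect.2.1 i : ℤ) : ℝ) - w.reflect.1 * y t i) =
          - ∑ i, w.2.1 i * x t i - w.1 * ∑ i, x t i * y t i := by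
        rw [Finset.mul_sum, ← Finset.sum_neg_distrib, ← Finset.sum_sub_distrib]
        refine Finset.sum_congr rfl fun i _ => ?_
        simp [IntTriple.reflect]; ring
      rw [this]; simp only [IntTriple.reflect]; ring
    rw [e]
    calc _ ≤ 2 * κ / Q := h3
      _ ≤ 1 / Q := by gcongr
      _ ≤ _ := by
          refine one_div_le_one_div_of_le (by positivity) ?_
          nlinarith

lemma LegendrePair.card_cells_le {ι : Type*} {m : ℕ} {x y : ι → Fin m → ℝ}
    {u : ι → ℝ} {C : ℝ} (h : LegendrePair x y u C) {Q r δ P : ℝ} (hQ : 1 ≤ Q) (hr : 0 < r)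
    (hδ : Q * r ^ 2 = δ) (hP : 1 ≤ P) (hδP : δ * P ≤ 1)
    (rep : (Fin m → ℤ) → ι) (S : Finset (Fin m → ℤ))
    (hrep : ∀ c ∈ S, ∀ i, ⌊x (rep c) i / r⌋ = c i) (d : ℝ) (hd : P ≤ d) (a : Fin m → ℝ)
    (ha : ∀ c ∈ S, ∀ i, |a i + d * y (rep c) i| ≤ 1 / (2 * (Q * r))) :
    (S.card : ℝ) ≤ (5 * C) ^ m / (δ * P) ^ m := by
  have hC := h.one_le
  have hQ0 : 0 < Q := by linarith
  have hP0 : 0 < P := by linarith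
  have hd0 : 0 < d := by linarith
  have hδ0 : 0 < δ := by rw [← hδ]; positivity
  have hone : 1 ≤ C / (δ * P) := by
    rw [one_le_div (by positivity)]; linarith
  rcases S.eq_empty_or_nonempty with rfl | ⟨c₀, hc₀⟩
  · simp only [Finset.card_empty, Nat.cast_zero]; positivity
  have hclose : ∀ c ∈ S, ∀ i, |(c i : ℝ) - c₀ i| ≤ C / (δ * P) + 1 := by
    intro c hc i
    have hy : ‖y (rep c) - y (rep c₀)‖ ≤ 1 / (P * (Q * r)) := by
      refine (pi_norm_le_iff_of_nonneg (by positivity)).2 fun j => ?_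
      have e : (y (rep c) - y (rep c₀)) j =
          ((a j + d * y (rep c) j) - (a j + d * y (rep c₀) j)) / d := by
        rw [Pi.sub_apply]; field_simp; ring
      rw [e, Real.norm_eq_abs, abs_div, abs_of_pos hd0, div_le_div_iff₀ hd0 (by positivity)]
      have h2 : |(a j + d * y (rep c) j) - (a j + d * y (rep c₀) j)| ≤ 1 / (Q * r) := by
        have e2 : 1 / (Q * r) = 1 / (2 * (Q * r)) + 1 / (2 * (Q * r)) := by field_simp; norm_num
        rw [e2]
        exact (abs_sub _ _).trans (add_le_add (ha c hc j) (ha c₀ hc₀ j))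
      calc _ ≤ 1 / (Q * r) * (P * (Q * r)) := by gcongr
        _ = P := by field_simp
        _ ≤ 1 * d := by linarith
    have hx : |x (rep c) i - x (rep c₀) i| ≤ C / (P * (Q * r)) := by
      refine (norm_le_pi_norm (x (rep c) - x (rep c₀)) i).trans
        ((h.norm_x_sub_le _ _).trans ?_)
      rw [div_eq_mul_one_div]; gcongr
    have hxr : |x (rep c) i / r - x (rep c₀) i / r| ≤ C / (δ * P) := by
      rw [← sub_div, abs_div, abs_of_pos hr, div_le_iff₀ hr]
      refine hx.trans (le_of_eq ?_)
      rw [← hδ]; field_simp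
    rw [← hrep c hc i, ← hrep c₀ hc₀ i]
    have f1 := Int.floor_le (x (rep c) i / r)
    have f2 := Int.lt_floor_add_one (x (rep c) i / r)
    have f3 := Int.floor_le (x (rep c₀) i / r)
    have f4 := Int.lt_floor_add_one (x (rep c₀) i / r)
    rw [abs_le] at hxr ⊢
    constructor <;> linarith
  calc (S.card : ℝ) ≤ (2 * (C / (δ * P) + 1) + 1) ^ m :=
        card_le_of_abs_sub_le S (fun i => c₀ i) (by positivity) hclose
    _ ≤ (5 * (C / (δ * P))) ^ m := by gcongr; linarith
    _ = _ := by rw [← mul_div_assoc, div_pow]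

lemma sum_two_pow_rpow_le {β δ : ℝ} (hβ : β < 1) (hδ : 0 < δ) {n : ℕ} (hn : δ * 2 ^ n ≤ 1) :
    ∑ k ∈ Finset.range (n + 1), ((2 : ℝ) ^ k) ^ (1 - β) ≤
      2 ^ (1 - β) / (2 ^ (1 - β) - 1) * δ ^ (β - 1) := by
  set p : ℝ := 2 ^ (1 - β) with hp
  have hp1 : 1 < p := Real.one_lt_rpow (by norm_num) (by linarith)
  have hpn : p ^ n ≤ δ ^ (β - 1) := by
    rw [hp, Real.rpow_pow_comm (by norm_num)]
    calc _ ≤ (1 / δ) ^ (1 - β) := by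
          refine Real.rpow_le_rpow (by positivity) ?_ (by linarith)
          rw [le_div_iff₀ hδ]; linarith
      _ = _ := by
          rw [one_div, Real.inv_rpow hδ.le, ← Real.rpow_neg hδ.le]; congr 1; ring
  simp_rw [← Real.rpow_pow_comm (zero_le_two : (0 : ℝ) ≤ 2), ← hp]
  rw [geom_sum_eq hp1.ne', div_mul_eq_mul_div]
  refine div_le_div_of_nonneg_right ?_ (by linarith)
  rw [pow_succ']
  nlinarith

open Classical in
lemma LegendrePair.exists_dual_finset {ι : Type*} {m : ℕ} {x y : ι → Fin m → ℝ}
    {u : ι → ℝ} {Q r δ κ : ℝ} (hQ : 1 ≤ Q) (hr : 0 < r)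
    (hδ : Q * r ^ 2 = δ) (hQr : 1 ≤ Q * r) (hκ0 : 0 < κ) (hκ : 2 * κ < 1) (t : ι)
    (W : ℕ → Finset (IntTriple m))
    (hW : ∀ k, nearPoints y x (fun t => ∑ i, x t i * y t i - u t)
        (2 ^ k) (1 / (δ * Q * 2 ^ k)) ⊆ W k) :
    ∃ D : Finset (IntTriple m),
      (∀ w : IntTriple m, w.toReal ∈ shearBox (x t) (y t) (u t) (2 * κ / δ)
        (2 * κ / (Q * r)) (2 * κ / Q) → w ∈ D) ∧
      D.card ≤ 1 + 2 * ∑ k ∈ Finset.range (Nat.log 2 ⌊1 / δ⌋₊ + 1),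
        ((W k).filter fun z => z.reflect.toReal ∈ shearBox (x t) (y t) (u t) (2 * κ / δ)
          (2 * κ / (Q * r)) (2 * κ / Q)).card := by
  have hδ0 : 0 < δ := by rw [← hδ]; positivity
  set B := shearBox (x t) (y t) (u t) (2 * κ / δ) (2 * κ / (Q * r)) (2 * κ / Q) with hB
  set V : Finset (IntTriple m) := (Finset.range (Nat.log 2 ⌊1 / δ⌋₊ + 1)).biUnion fun k =>
    ((W k).filter fun z => z.reflect.toReal ∈ B).image IntTriple.reflect with hV
  have hpos : ∀ w : IntTriple m, 1 ≤ w.1 → w.toReal ∈ B → w ∈ V := by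
    intro w hw1 hw
    obtain ⟨h1, h2⟩ := reflect_mem_nearPoints hQ hr hδ hκ.le hw1 hw
    refine Finset.mem_biUnion.2 ⟨Nat.log 2 w.1.toNat, ?_, ?_⟩
    · rw [Finset.mem_range, Nat.lt_succ_iff]
      refine Nat.le_log_of_pow_le (by norm_num) (Nat.le_floor ?_)
      rw [le_div_iff₀ hδ0]; push_cast; linarith
    · refine Finset.mem_image.2 ⟨w.reflect, Finset.mem_filter.2 ⟨hW _ h2, ?_⟩, by simp⟩
      simpa using hw
  refine ⟨{0} ∪ (V ∪ V.image Neg.neg), fun w hw => ?_, ?_⟩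
  · simp only [Finset.mem_union, Finset.mem_singleton]
    rcases lt_trichotomy w.1 0 with h0 | h0 | h0
    · right; right
      refine Finset.mem_image.2 ⟨-w, hpos (-w) (by simp; omega) ?_, by simp⟩
      obtain ⟨h1, h2, h3⟩ := hw
      refine ⟨?_, fun i => ?_, ?_⟩
      · simpa [IntTriple.toReal] using h1
      · rw [← abs_neg]
        refine le_trans (le_of_eq ?_) (h2 i)
        congr 1; simp [IntTriple.toReal]; ring
      · rw [← abs_neg]
        refine le_trans (le_of_eq ?_) h3
        congr 1; simp [IntTriple.toReal]; ring
    · left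
      obtain ⟨h1, h2, h3⟩ := hw
      simp only [IntTriple.toReal, h0, Int.cast_zero, zero_mul, add_zero] at h2 h3
      have hsmall : ∀ {k : ℤ} {s : ℝ}, 1 ≤ s → |(k : ℝ)| ≤ 2 * κ / s → k = 0 := by
        intro k s hs hk
        have : |(k : ℝ)| < 1 := hk.trans_lt (by rw [div_lt_one (by linarith)]; linarith)
        rw [← Int.cast_abs] at this
        exact Int.abs_lt_one_iff.1 (by exact_mod_cast this)
      have hc : ∀ i, w.2.1 i = 0 := fun i => hsmall hQr (h2 i)
      have hc0 : w.2.2 = 0 := hsmall hQ (by simpa [hc] using h3)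
      exact Prod.ext h0 (Prod.ext (funext hc) hc0)
    · right; left
      exact hpos w (by omega) hw
  · have hVc : V.card ≤ ∑ k ∈ Finset.range (Nat.log 2 ⌊1 / δ⌋₊ + 1),
        ((W k).filter fun z => z.reflect.toReal ∈ B).card :=
      Finset.card_biUnion_le.trans (Finset.sum_le_sum fun k _ => Finset.card_image_le)
    have h1 := Finset.card_union_le ({0} : Finset (IntTriple m)) (V ∪ V.image Neg.neg)
    have h2 := Finset.card_union_le V (V.image Neg.neg)
    have h3 := Finset.card_image_le (s := V) (f := Neg.neg)
    rw [Finset.card_singleton] at h1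
    omega

open Classical in
lemma LegendrePair.ncard_nearPoints_le {ι : Type*} {m : ℕ} (hm : 2 ≤ m)
    {x y : ι → Fin m → ℝ} {u : ι → ℝ} {C : ℝ} (h : LegendrePair x y u C) {β K : ℝ} (hβ : β < 1)
    (hK0 : 0 ≤ K)
    (hK : ∀ Q δ : ℝ, 1 ≤ Q → 0 < δ → δ ≤ 1 →
      ((nearPoints y x (fun t => ∑ i, x t i * y t i - u t) Q δ).ncard : ℝ) ≤
        K * (Q ^ (m + 1) * (δ + Q ^ (-β)))) :
    ∃ K' : ℝ, 0 ≤ K' ∧ ∀ Q δ : ℝ, 1 ≤ Q → 0 < δ → δ ≤ 1 → 1 ≤ δ * Q →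
      ((nearPoints x y u Q δ).ncard : ℝ) ≤
        K' * (δ * Q ^ (m + 1) * (1 + δ ^ (β - 1) / (δ * Q))) := by
  have hC := h.one_le
  set κ : ℝ := 1 / (6 * ((6 * m + 5) * C)) with hκ
  have hmC : 1 ≤ (6 * m + 5) * C := by nlinarith [(m.cast_nonneg : (0 : ℝ) ≤ m)]
  have hκ0 : 0 < κ := by positivity
  have hκ1 : 4 * κ ≤ 1 := by
    rw [hκ, mul_one_div, div_le_one (by positivity)]; linarith
  have hκF : κ * (2 + 4 * m + (2 * m + 3) * C) ≤ 1 / 6 := by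
    calc _ ≤ κ * ((6 * m + 5) * C) := by
          gcongr; nlinarith [(m.cast_nonneg : (0 : ℝ) ≤ m)]
      _ = 1 / 6 := by rw [hκ]; field_simp
  set g : ℝ := 2 ^ (1 - β) / (2 ^ (1 - β) - 1) with hg
  have hg0 : 0 ≤ g := by
    have : (1 : ℝ) < 2 ^ (1 - β) := Real.one_lt_rpow (by norm_num) (by linarith)
    exact div_nonneg (by positivity) (by linarith)
  refine ⟨4 * (5 * C) ^ m / (2 * κ) ^ (m + 2) * (1 + 4 * K * g), by positivity,
    fun Q δ hQ hδ0 hδ1 hδQ => ?_⟩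
  have hQ0 : 0 < Q := by linarith
  set r : ℝ := √(δ / Q) with hrdef
  have hr : 0 < r := Real.sqrt_pos.2 (by positivity)
  have hr2 : Q * r ^ 2 = δ := by
    rw [hrdef, Real.sq_sqrt (by positivity)]; field_simp
  have hr1 : r ≤ 1 := Real.sqrt_le_one.2 (by rw [div_le_one hQ0]; linarith)
  have hR2 : (Q * r) ^ 2 = δ * Q := by rw [← hr2]; ring
  have hR : 1 ≤ Q * r := by
    have : 0 < Q * r := by positivity
    nlinarith
  rcases isEmpty_or_nonempty ι with hι | hι
  · have : nearPoints x y u Q δ = ∅ := by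
      ext z; simp [nearPoints]
    rw [this, Set.ncard_empty, Nat.cast_zero]; positivity
  set N := (h.finite_nearPoints hQ hδ1).toFinset with hN
  have hNmem : ∀ z ∈ N, z ∈ nearPoints x y u Q δ := fun z hz => by simpa [hN] using hz
  have hwit : ∀ z ∈ N, ∃ t, (∀ i, ((z.2.1 i : ℝ) - z.1 * x t i) ^ 2 ≤ δ * z.1) ∧
      |(z.2.2 : ℝ) - z.1 * u t - ∑ i, y t i * (z.2.1 i - z.1 * x t i)| ≤ δ :=
    fun z hz => (hNmem z hz).2.2
  choose! wit hwit using hwit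
  set cell : ι → Fin m → ℤ := fun t i => ⌊x t i / r⌋ with hcell
  set rep := Function.invFun cell with hrep
  set T := N.image fun z => cell (wit z) with hT
  have hrepT : ∀ c ∈ T, cell (rep c) = c := by
    intro c hc
    obtain ⟨z, _, rfl⟩ := Finset.mem_image.1 hc
    exact Function.invFun_eq ⟨wit z, rfl⟩
  have hTcard : (T.card : ℝ) ≤ (5 * C) ^ m / r ^ m := by
    have hCr : 1 ≤ C / r := by rw [one_le_div hr]; linarith
    have := card_le_of_abs_sub_le T 0 (ρ := C / r + 1) (by positivity) fun c hc i => by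
      rw [← hrepT c hc, Pi.zero_apply, sub_zero]
      have hx : |x (rep c) i / r| ≤ C / r := by
        rw [abs_div, abs_of_pos hr]; gcongr; exact h.abs_x_le _ _
      have f1 := Int.floor_le (x (rep c) i / r)
      have f2 := Int.lt_floor_add_one (x (rep c) i / r)
      simp only [hcell]
      rw [abs_le] at hx ⊢
      constructor <;> linarith
    calc _ ≤ (2 * (C / r + 1) + 1) ^ m := this
      _ ≤ (5 * (C / r)) ^ m := by gcongr; linarith
      _ = _ := by rw [← mul_div_assoc, div_pow]
  have hδk : ∀ k : ℕ, 1 ≤ δ * Q * 2 ^ k := fun k =>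
    one_le_mul_of_one_le_of_one_le hδQ (one_le_pow₀ (by norm_num))
  have hδk' : ∀ k : ℕ, 1 / (δ * Q * 2 ^ k) ≤ 1 := fun k => by
    rw [div_le_one (by linarith [hδk k])]; exact hδk k
  have h2k : ∀ k : ℕ, (1 : ℝ) ≤ 2 ^ k := fun k => one_le_pow₀ (by norm_num)
  set W : ℕ → Finset (IntTriple m) := fun k =>
    (h.dual.finite_nearPoints (h2k k) (hδk' k)).toFinset with hW
  set n := Nat.log 2 ⌊1 / δ⌋₊ with hn
  have hδn : δ * 2 ^ n ≤ 1 := by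
    have h1 : 2 ^ n ≤ ⌊1 / δ⌋₊ := Nat.pow_log_le_self 2 (Nat.floor_pos.2 (by
      rwa [one_le_div hδ0])).ne'
    have h2 : (2 : ℝ) ^ n ≤ 1 / δ :=
      le_trans (by exact_mod_cast h1) (Nat.floor_le (by positivity))
    rw [le_div_iff₀ hδ0] at h2; linarith
  have hWcard : ∀ k, ((W k).card : ℝ) ≤ 2 * K * (2 ^ k) ^ (m + 1) * (2 ^ k) ^ (-β) := by
    intro k
    have h1 := hK (2 ^ k) (1 / (δ * Q * 2 ^ k)) (h2k k)
      (by have := hδk k; positivity) (hδk' k)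
    rw [Set.ncard_eq_toFinset_card _ (h.dual.finite_nearPoints (h2k k) (hδk' k))] at h1
    have h3 : 1 / (δ * Q * 2 ^ k) ≤ ((2 : ℝ) ^ k) ^ (-β) := by
      calc 1 / (δ * Q * 2 ^ k) ≤ 1 / 2 ^ k := by
            refine one_div_le_one_div_of_le (by positivity) ?_
            exact le_mul_of_one_le_left (by positivity) hδQ
        _ = ((2 : ℝ) ^ k) ^ (-1 : ℝ) := by rw [Real.rpow_neg_one, one_div]
        _ ≤ _ := Real.rpow_le_rpow_of_exponent_le (h2k k) (by linarith)
    calc _ ≤ _ := h1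
      _ ≤ K * ((2 ^ k) ^ (m + 1) * ((2 ^ k) ^ (-β) + (2 ^ k) ^ (-β))) := by gcongr
      _ = _ := by ring
  set B : (Fin m → ℤ) → Set (RealTriple m) := fun c => shearBox (x (rep c)) (y (rep c))
    (u (rep c)) (2 * κ / δ) (2 * κ / (Q * r)) (2 * κ / Q) with hB
  set V : ℝ := (2 * κ / δ) * ((2 * κ / (Q * r)) ^ m * (2 * κ / Q)) with hV
  have hcellcard : ∀ c ∈ T, ((N.filter fun z => cell (wit z) = c).card : ℝ) * V ≤
      4 * (1 + 2 * ∑ k ∈ Finset.range (n + 1),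
        (((W k).filter fun z => z.reflect.toReal ∈ B c).card : ℝ)) := by
    intro c hc
    obtain ⟨D, hD1, hD2⟩ := LegendrePair.exists_dual_finset hQ hr hr2 hR hκ0 (by linarith)
      (x := x) (y := y) (u := u) (rep c) W (fun k => by simp [hW])
    have h1 := card_mul_le_card_dual (x (rep c)) (y (rep c)) (u (rep c)) (Q := Q) (δ := δ)
      (R := Q * r) (κ := κ) (F := (2 * m + 3) * C) hQ0 hδ0 (by positivity) hκ0 hκF
      (N.filter fun z => cell (wit z) = c) D ?_ hD1
    · refine h1.trans ?_
      have : (D.card : ℝ) ≤ 1 + 2 * ∑ k ∈ Finset.range (n + 1),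
        (((W k).filter fun z => z.reflect.toReal ∈ B c).card : ℝ) := by exact_mod_cast hD2
      gcongr
    · intro z hz
      obtain ⟨hzN, hzc⟩ := Finset.mem_filter.1 hz
      obtain ⟨g1, g2, _⟩ := hNmem z hzN
      refine h.form_bounds_of_near hQ hr hr2 g1 g2 (hwit z hzN).1 (hwit z hzN).2 fun i => ?_
      have hfl : ⌊x (wit z) i / r⌋ = ⌊x (rep c) i / r⌋ := by
        have := congrFun (hzc.trans (hrepT c hc).symm) i
        exact this
      have := (Int.abs_sub_lt_one_of_floor_eq_floor hfl).le
      rwa [← sub_div, abs_div, abs_of_pos hr, div_le_one hr] at this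
  have hswap : ∀ k ∈ Finset.range (n + 1),
      ∑ c ∈ T, (((W k).filter fun z => z.reflect.toReal ∈ B c).card : ℝ) ≤
      2 * K * ((5 * C) ^ m / δ ^ m) * (2 ^ k) ^ (1 - β) := by
    intro k hk
    have hk' : (2 : ℝ) ^ k ≤ 2 ^ n :=
      pow_le_pow_right₀ (by norm_num) (Nat.lt_succ_iff.1 (Finset.mem_range.1 hk))
    have hδk1 : δ * 2 ^ k ≤ 1 := (mul_le_mul_of_nonneg_left hk' hδ0.le).trans hδn
    have hsw := Finset.sum_card_bipartiteAbove_eq_sum_card_bipartiteBelow (s := T) (t := W k)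
      (fun c z => z.reflect.toReal ∈ B c)
    have hsw' : ∑ c ∈ T, (((W k).filter fun z => z.reflect.toReal ∈ B c).card : ℝ) =
        ∑ z ∈ W k, ((T.filter fun c => z.reflect.toReal ∈ B c).card : ℝ) := by
      exact_mod_cast hsw
    rw [hsw']
    have hbound : ∀ z ∈ W k, ((T.filter fun c => z.reflect.toReal ∈ B c).card : ℝ) ≤
        (5 * C) ^ m / (δ * 2 ^ k) ^ m := by
      intro z hz
      have hz' : z ∈ nearPoints y x (fun t => ∑ i, x t i * y t i - u t) (2 ^ k)
          (1 / (δ * Q * 2 ^ k)) := by simpa [hW] using hz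
      refine h.card_cells_le hQ hr hr2 (h2k k) hδk1 rep _
        (fun c hc i => congrFun (hrepT c (Finset.mem_filter.1 hc).1) i) z.1 hz'.1
        (fun i => (z.reflect.2.1 i : ℝ)) fun c hc i => ?_
      refine ((Finset.mem_filter.1 hc).2.2.1 i).trans ?_
      rw [div_le_div_iff₀ (by positivity) (by positivity)]
      nlinarith
    calc _ ≤ ∑ _z ∈ W k, (5 * C) ^ m / (δ * 2 ^ k) ^ m := Finset.sum_le_sum hbound
      _ = (W k).card * ((5 * C) ^ m / (δ * 2 ^ k) ^ m) := by
          rw [Finset.sum_const, nsmul_eq_mul]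
      _ ≤ 2 * K * (2 ^ k) ^ (m + 1) * (2 ^ k) ^ (-β) * ((5 * C) ^ m / (δ * 2 ^ k) ^ m) := by
          gcongr; exact hWcard k
      _ = _ := by
          rw [sub_eq_add_neg, Real.rpow_add (by positivity), Real.rpow_one, mul_pow δ, pow_succ]
          field_simp
  have htotal : (N.card : ℝ) * V ≤
      4 * ((5 * C) ^ m / r ^ m) + 8 * (2 * K * ((5 * C) ^ m / δ ^ m) * (g * δ ^ (β - 1))) := by
    have hNsum : (N.card : ℝ) = ∑ c ∈ T, ((N.filter fun z => cell (wit z) = c).card : ℝ) := by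
      exact_mod_cast Finset.card_eq_sum_card_image (fun z => cell (wit z)) N
    calc (N.card : ℝ) * V = ∑ c ∈ T, ((N.filter fun z => cell (wit z) = c).card : ℝ) * V := by
          rw [hNsum, Finset.sum_mul]
      _ ≤ ∑ c ∈ T, 4 * (1 + 2 * ∑ k ∈ Finset.range (n + 1),
            (((W k).filter fun z => z.reflect.toReal ∈ B c).card : ℝ)) :=
          Finset.sum_le_sum hcellcard
      _ = 4 * T.card + 8 * ∑ k ∈ Finset.range (n + 1), ∑ c ∈ T,
            (((W k).filter fun z => z.reflect.toReal ∈ B c).card : ℝ) := by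
          rw [← Finset.mul_sum, Finset.sum_add_distrib, ← Finset.mul_sum, Finset.sum_comm]
          simp; ring
      _ ≤ 4 * ((5 * C) ^ m / r ^ m) + 8 * ∑ k ∈ Finset.range (n + 1),
            2 * K * ((5 * C) ^ m / δ ^ m) * (2 ^ k) ^ (1 - β) := by
          gcongr with k hk
          exact hswap k hk
      _ ≤ _ := by
          rw [← Finset.mul_sum]
          gcongr
          exact sum_two_pow_rpow_le hβ hδ0 hδn
  have hVpos : 0 < V := by positivity
  rw [Set.ncard_eq_toFinset_card _ (h.finite_nearPoints hQ hδ1), ← hN,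
    ← mul_le_mul_iff_of_pos_right hVpos]
  refine htotal.trans ?_
  have hRm : δ * Q ≤ (Q * r) ^ m := by
    rw [← hR2]; exact pow_le_pow_right₀ hR hm
  have hVeq : V = (2 * κ) ^ (m + 2) / (δ * Q * (Q * r) ^ m) := by
    rw [hV, div_pow]; field_simp; ring
  have hrhs : 4 * (5 * C) ^ m / (2 * κ) ^ (m + 2) * (1 + 4 * K * g) *
      (δ * Q ^ (m + 1) * (1 + δ ^ (β - 1) / (δ * Q))) * V =
      4 * (5 * C) ^ m * (1 + 4 * K * g) * ((1 + δ ^ (β - 1) / (δ * Q)) * (1 / r ^ m)) := by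
    rw [hVeq, mul_pow Q r]; field_simp; ring
  rw [hrhs]
  have hδm : 1 / δ ^ m ≤ 1 / (δ * Q) * (1 / r ^ m) := by
    have e : δ ^ m = (Q * r) ^ m * r ^ m := by rw [← mul_pow, ← hr2]; ring
    rw [e, one_div_mul_one_div]
    exact one_div_le_one_div_of_le (by positivity) (by gcongr)
  have hD0 : 0 < δ ^ (β - 1) := Real.rpow_pos_of_pos hδ0 _
  calc 4 * ((5 * C) ^ m / r ^ m) + 8 * (2 * K * ((5 * C) ^ m / δ ^ m) * (g * δ ^ (β - 1)))
      = 4 * (5 * C) ^ m * (1 / r ^ m + 4 * K * g * (δ ^ (β - 1) * (1 / δ ^ m))) := by ring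
    _ ≤ 4 * (5 * C) ^ m * (1 / r ^ m +
          4 * K * g * (δ ^ (β - 1) * (1 / (δ * Q) * (1 / r ^ m)))) := by gcongr
    _ ≤ _ := by
        have h0 : 0 ≤ (δ ^ (β - 1) * (1 / (δ * Q) * (1 / r ^ m))) := by positivity
        have h1 : 0 ≤ 4 * K * g * (1 / r ^ m) := by positivity
        rw [mul_assoc (4 * (5 * C) ^ m)]
        gcongr
        have : (1 + 4 * K * g) * ((1 + δ ^ (β - 1) / (δ * Q)) * (1 / r ^ m)) =
          1 / r ^ m + 4 * K * g * (1 / r ^ m) + (δ ^ (β - 1) * (1 / (δ * Q) * (1 / r ^ m))) +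
          4 * K * g * (δ ^ (β - 1) * (1 / (δ * Q) * (1 / r ^ m))) := by ring
        rw [this]
        linarith

lemma CountingBound.improve {ι : Type*} {m : ℕ} (hm : 2 ≤ m) {β : ℝ} (hβ : β < 1)
    (h : CountingBound ι m β) : CountingBound ι m (1 / (2 - β)) := by
  intro x y u C hL
  obtain ⟨K, hK0, hK⟩ := h _ _ _ _ hL.dual
  obtain ⟨K', hK'0, hK'⟩ := hL.ncard_nearPoints_le hm hβ hK0 hK
  set γ : ℝ := 1 / (2 - β) with hγ
  have h2β : 0 < 2 - β := by linarith
  have hγ0 : 0 < γ := by positivity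
  have hγ1 : γ < 1 := by rw [hγ, div_lt_one h2β]; linarith
  have key : ∀ Q δ : ℝ, 1 ≤ Q → Q ^ (-γ) ≤ δ → δ ≤ 1 →
      ((nearPoints x y u Q δ).ncard : ℝ) ≤ 2 * K' * (Q ^ (m + 1) * δ) := by
    intro Q δ hQ hδ hδ1
    have hQ0 : 0 < Q := by linarith
    have hδ0 : 0 < δ := lt_of_lt_of_le (Real.rpow_pos_of_pos hQ0 _) hδ
    have hQδ : 1 ≤ δ * Q := by
      have : Q ^ (-1 : ℝ) ≤ δ :=
        (Real.rpow_le_rpow_of_exponent_le hQ (by linarith)).trans hδ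
      rwa [Real.rpow_neg_one, inv_le_iff_one_le_mul₀ hQ0] at this
    have h1 : δ ^ (β - 1) / (δ * Q) ≤ 1 := by
      rw [div_le_one (by positivity)]
      have h2 : Q⁻¹ ≤ δ ^ (2 - β) := by
        have := Real.rpow_le_rpow (by positivity) hδ h2β.le
        rw [← Real.rpow_mul hQ0.le] at this
        have e : -γ * (2 - β) = -1 := by rw [hγ]; field_simp
        rwa [e, Real.rpow_neg_one] at this
      have h3 : δ = δ ^ (β - 1) * δ ^ (2 - β) := by
        rw [← Real.rpow_add hδ0]; ring_nf; rw [Real.rpow_one]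
      calc δ ^ (β - 1) = δ ^ (β - 1) * (Q⁻¹ * Q) := by field_simp
        _ ≤ δ ^ (β - 1) * (δ ^ (2 - β) * Q) := by gcongr
        _ = δ * Q := by rw [← mul_assoc, ← h3]
    calc _ ≤ _ := hK' Q δ hQ hδ0 hδ1 hQδ
      _ ≤ K' * (δ * Q ^ (m + 1) * (1 + 1)) := by gcongr
      _ = _ := by ring
  refine ⟨2 * K', by positivity, fun Q δ hQ hδ0 hδ1 => ?_⟩
  have hQ0 : 0 < Q := by linarith
  have hp : 0 < Q ^ (-γ) := Real.rpow_pos_of_pos hQ0 _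
  rcases le_total (Q ^ (-γ)) δ with hle | hle
  · refine (key Q δ hQ hle hδ1).trans ?_
    gcongr; linarith
  · have h1 : Q ^ (-γ) ≤ 1 := Real.rpow_le_one_of_one_le_of_nonpos hQ (by linarith)
    have h2 : ((nearPoints x y u Q δ).ncard : ℝ) ≤ (nearPoints x y u Q (Q ^ (-γ))).ncard := by
      exact_mod_cast Set.ncard_le_ncard (nearPoints_mono x y u hQ hle)
        (hL.finite_nearPoints hQ h1)
    refine h2.trans ((key Q _ hQ le_rfl h1).trans ?_)
    gcongr; linarith

lemma countingBound_odd_div_odd (ι : Type*) {m : ℕ} (hm : 2 ≤ m) (k : ℕ) :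
    CountingBound ι m ((2 * k - 1) / (2 * k + 1)) := by
  induction k with
  | zero => simpa using countingBound_neg_one ι m
  | succ k ih =>
    have hk : (0 : ℝ) < 2 * k + 1 := by positivity
    convert ih.improve hm (by rw [div_lt_one hk]; linarith) using 1
    have : (0 : ℝ) < 2 * k + 3 := by positivity
    have e : 2 - (2 * (k : ℝ) - 1) / (2 * k + 1) = (2 * k + 3) / (2 * k + 1) := by
      field_simp; ring
    rw [e, one_div_div]
    push_cast
    congr 1 <;> ring

/-- The error exponent `β` can be taken arbitrarily close to `1`. -/
lemma exists_countingBound (ι : Type*) {m : ℕ} (hm : 2 ≤ m) {β : ℝ} (hβ : β < 1) :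
    ∃ γ, β < γ ∧ CountingBound ι m γ := by
  obtain ⟨k, hk⟩ := exists_nat_gt (1 / (1 - β))
  refine ⟨_, ?_, countingBound_odd_div_odd ι hm k⟩
  have h1 : 0 < 1 - β := by linarith
  rw [div_lt_iff₀ h1] at hk
  rw [lt_div_iff₀ (by positivity)]
  nlinarith

open Filter Topology ENNReal in
/-- The convergence part of the Hausdorff–Cantelli lemma. -/
lemma hausdorffMeasure_eq_zero_of_frequently {X τ : Type*} [MetricSpace X] [MeasurableSpace X]
    [BorelSpace X] {s : ℝ} (hs : 0 < s) {E : Set X} (S : ℕ → Finset τ) (A : ℕ → τ → Set X)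
    {r : ℕ → ℝ} (hr0 : ∀ k, 0 ≤ r k) (hr : Antitone r) (hrt : Tendsto r atTop (𝓝 0))
    (hA : ∀ k z, Metric.ediam (A k z) ≤ ENNReal.ofReal (r k))
    (hsum : Summable fun k => ((S k).card : ℝ) * r k ^ s)
    (hE : ∀ x ∈ E, ∃ᶠ k in atTop, ∃ z ∈ S k, x ∈ A k z) : μH[s] E = 0 := by
  set F : ℕ → ℝ≥0∞ := fun k => ENNReal.ofReal ((S k).card * r k ^ s) with hF
  have hFt : Tendsto (fun n => ∑' k, F (k + n)) atTop (𝓝 0) :=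
    ENNReal.tendsto_sum_nat_add F hsum.tsum_ofReal_ne_top
  have hle := Measure.hausdorffMeasure_le_liminf_tsum s E (l := atTop)
    (fun n : ℕ => ENNReal.ofReal (r n))
    (by simpa [Function.comp_def] using (ENNReal.continuous_ofReal.tendsto 0).comp hrt)
    (ι := fun n => Σ k : ℕ, S (k + n)) (fun n i => A (i.1 + n) i.2)
    (Eventually.of_forall fun n i =>
      (hA _ _).trans (ENNReal.ofReal_le_ofReal (hr (Nat.le_add_left _ _))))
    (Eventually.of_forall fun n x hx => by
      obtain ⟨k, hk, z, hz, hxz⟩ := frequently_atTop.1 (hE x hx) n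
      obtain ⟨j, rfl⟩ := Nat.exists_eq_add_of_le' hk
      exact Set.mem_iUnion.2 ⟨⟨j, z, hz⟩, hxz⟩)
  refine le_antisymm (hle.trans ?_) zero_le
  rw [← hFt.liminf_eq]
  refine liminf_le_liminf (Eventually.of_forall fun n => ?_)
  rw [ENNReal.tsum_sigma fun k (z : S (k + n)) => Metric.ediam (A (k + n) z) ^ s]
  refine ENNReal.tsum_le_tsum fun k => ?_
  calc ∑' z : S (k + n), Metric.ediam (A (k + n) z) ^ s
      ≤ ∑' _z : S (k + n), ENNReal.ofReal (r (k + n)) ^ s :=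
        ENNReal.tsum_le_tsum fun z => ENNReal.rpow_le_rpow (hA _ _) hs.le
    _ = F (k + n) := by
        rw [tsum_fintype, Finset.sum_const, hF]
        simp only [Finset.card_univ, Fintype.card_coe, nsmul_eq_mul]
        rw [ENNReal.ofReal_mul (by positivity), ENNReal.ofReal_natCast,
          ENNReal.ofReal_rpow_of_nonneg (hr0 _) hs.le]

lemma summable_two_pow_mul_of_antitone {g : ℕ → ℝ} {p : ℝ} (hg0 : ∀ q, 0 ≤ g q)
    (hg : Antitone g) (hp : 0 ≤ p)
    (hsum : Summable fun q : ℕ => g (q + 1) * ((q : ℝ) + 1) ^ p) :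
    Summable fun k : ℕ => ((2 : ℝ) ^ k) ^ (p + 1) * g (2 ^ k) := by
  set F : ℕ → ℝ := fun q => g q * (q : ℝ) ^ p with hF
  have hF0 : ∀ q, 0 ≤ F q := fun q => mul_nonneg (hg0 q) (by positivity)
  have hsumF : Summable F := by
    rw [← summable_nat_add_iff 1]
    simpa [hF] using hsum
  have hblock : ∀ n : ℕ, ((2 : ℝ) ^ n) ^ (p + 1) * g (2 ^ (n + 1)) ≤
      ∑ i ∈ Finset.Ico (2 ^ n) (2 ^ (n + 1)), F i := by
    intro n
    have := Finset.card_nsmul_le_sum (Finset.Ico (2 ^ n) (2 ^ (n + 1))) F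
      (g (2 ^ (n + 1)) * ((2 : ℝ) ^ n) ^ p) fun i hi => by
        obtain ⟨h1, h2⟩ := Finset.mem_Ico.1 hi
        refine mul_le_mul (hg h2.le) (Real.rpow_le_rpow (by positivity) ?_ hp)
          (by positivity) (hg0 _)
        exact_mod_cast h1
    refine le_trans (le_of_eq ?_) this
    rw [Nat.card_Ico, nsmul_eq_mul, pow_succ 2 n, mul_two, Nat.add_sub_cancel,
      Real.rpow_add_one (by positivity)]
    push_cast; ring
  have hpart : ∀ n : ℕ, ∑ k ∈ Finset.range n, ((2 : ℝ) ^ k) ^ (p + 1) * g (2 ^ (k + 1)) ≤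
      ∑ i ∈ Finset.Ico 1 (2 ^ n), F i := by
    intro n
    induction n with
    | zero => simp
    | succ n ih =>
      rw [Finset.sum_range_succ, ← Finset.sum_Ico_consecutive F Nat.one_le_two_pow
        (Nat.pow_le_pow_right two_pos n.le_succ)]
      exact add_le_add ih (hblock n)
  have h1 : Summable fun k : ℕ => ((2 : ℝ) ^ k) ^ (p + 1) * g (2 ^ (k + 1)) :=
    summable_of_sum_range_le (fun k => mul_nonneg (by positivity) (hg0 _)) fun n =>
      (hpart n).trans (hsumF.sum_le_tsum _ fun i _ => hF0 i)
  rw [← summable_nat_add_iff 1]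
  refine (h1.mul_left (2 ^ (p + 1))).congr fun k => ?_
  rw [pow_succ (2 : ℝ) k, Real.mul_rpow (by positivity) (by positivity)]; ring

lemma rpow_mul_le_add {a b s : ℝ} (ha : 0 < a) (hb : 0 < b) (hs : 0 ≤ s) :
    a ^ s * b ≤ a ^ (s + 1) + b ^ (s + 1) := by
  rw [Real.rpow_add_one ha.ne', Real.rpow_add_one hb.ne']
  have h1 : 0 < a ^ s := Real.rpow_pos_of_pos ha s
  have h2 : 0 < b ^ s := Real.rpow_pos_of_pos hb s
  rcases le_total a b with h | h
  · have : a ^ s ≤ b ^ s := Real.rpow_le_rpow ha.le h hs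
    nlinarith
  · nlinarith

open Filter Topology in
lemma tendsto_zero_of_summable_rpow {ψ : ℕ → ℝ} (hψ : ∀ q, 0 < ψ q) {σ p : ℝ} (hσ : 0 < σ)
    (hp : 0 ≤ p) (hsum : Summable fun q : ℕ => ψ (q + 1) ^ σ * ((q : ℝ) + 1) ^ p) :
    Tendsto ψ atTop (𝓝 0) := by
  rw [← tendsto_add_atTop_iff_nat 1]
  have h1 : Summable fun q : ℕ => ψ (q + 1) ^ σ :=
    hsum.of_nonneg_of_le (fun q => (Real.rpow_pos_of_pos (hψ _) _).le) fun q =>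
      le_mul_of_one_le_right (Real.rpow_pos_of_pos (hψ _) _).le
        (Real.one_le_rpow (by linarith [(q.cast_nonneg : (0 : ℝ) ≤ q)]) hp)
  have h2 := h1.tendsto_atTop_zero.rpow_const (p := σ⁻¹) (Or.inr (by positivity))
  rw [Real.zero_rpow (by positivity)] at h2
  refine h2.congr fun q => ?_
  rw [← Real.rpow_mul (hψ _).le, mul_inv_cancel₀ hσ.ne', Real.rpow_one]

open Filter Topology in
lemma LegendrePair.frequently_mem_nearPoints {m : ℕ} {U : Set (Fin m → ℝ)}
    {f : (Fin m → ℝ) → ℝ} {y : (Fin m → ℝ) → Fin m → ℝ} {C : ℝ}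
    (h : LegendrePair (fun t : U => t.1) (fun t : U => y t) (fun t : U => f t) C)
    {ψ : ℕ → ℝ} (hψpos : ∀ q, 0 < ψ q) (hψdec : Antitone ψ) (hψ0 : Tendsto ψ atTop (𝓝 0))
    {x : Fin m → ℝ} (hx : x ∈ U)
    (hinf : {t : ℕ × (Fin m → ℤ) × ℤ | 1 ≤ t.1 ∧
      (∀ i, |x i - (t.2.1 i : ℝ) / (t.1 : ℝ)| < ψ t.1 / (t.1 : ℝ)) ∧
      |f x - (t.2.2 : ℝ) / (t.1 : ℝ)| < ψ t.1 / (t.1 : ℝ)}.Infinite) :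
    ∃ᶠ k : ℕ in atTop, ∃ z ∈ nearPoints (fun t : U => t.1) (fun t : U => y t)
        (fun t : U => f t) (2 ^ k) ((1 + m * C) * ψ (2 ^ k)),
      ∀ i, |x i - (z.2.1 i : ℝ) / z.1| ≤ ψ (2 ^ k) / 2 ^ k := by
  have hC := h.one_le
  rw [frequently_atTop]
  intro k₀
  obtain ⟨k₁, hk₁⟩ := eventually_atTop.1 (hψ0.eventually (gt_mem_nhds one_pos))
  by_contra hcon
  refine hinf ?_
  set N : ℕ := 2 ^ max k₀ k₁ with hN
  set X : ℝ := N * C + ψ 0 with hX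
  refine Set.Finite.of_finite_image (f := fun t => ((t.1 : ℤ), t.2.1, t.2.2))
    ((Finset.finite_toSet (intBox m X)).subset ?_) ?_
  swap
  · rintro ⟨a, b, c⟩ _ ⟨a', b', c'⟩ _ hab
    simp only [Prod.mk.injEq, Nat.cast_inj] at hab
    simp [hab]
  rintro _ ⟨⟨q, a, b⟩, ⟨hq1, ha, hb⟩, rfl⟩
  simp only at hq1 ha hb
  have hq0 : (0 : ℝ) < q := by exact_mod_cast hq1
  have hsc : ∀ {v : ℝ} {c : ℤ}, |v - c / q| < ψ q / q → |(c : ℝ) - q * v| < ψ q := by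
    intro v c hv
    rw [lt_div_iff₀ hq0, ← abs_of_pos hq0, ← abs_mul, abs_of_pos hq0, sub_mul,
      div_mul_cancel₀ _ hq0.ne', abs_sub_comm] at hv
    rwa [mul_comm]
  have ha' : ∀ i, |(a i : ℝ) - q * x i| < ψ q := fun i => hsc (ha i)
  have hb' : |(b : ℝ) - q * f x| < ψ q := hsc hb
  have hqN : q < N := by
    by_contra hqN
    push Not at hqN
    refine hcon ⟨Nat.log 2 q, ?_, ((q : ℤ), a, b), ?_, ?_⟩
    · exact (le_max_left _ _).trans (Nat.le_log_of_pow_le one_lt_two hqN)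
    all_goals
      set k := Nat.log 2 q with hk
      have hkq : 2 ^ k ≤ q := Nat.pow_log_le_self 2 (by omega)
      have hkq' : (2 : ℝ) ^ k ≤ q := by exact_mod_cast hkq
      have hψk : ψ q ≤ ψ (2 ^ k) := hψdec hkq
    · have hq2 : (q : ℝ) ≤ 2 * 2 ^ k := by
        have := (Nat.lt_pow_succ_log_self one_lt_two q).le
        rw [pow_succ, mul_comm] at this
        exact_mod_cast this
      have hψ1 : ψ q < 1 := hk₁ q (by
        have : max k₀ k₁ < 2 ^ max k₀ k₁ := Nat.lt_two_pow_self
        omega)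
      have hm0 : 0 ≤ m * C := by positivity
      refine ⟨by simpa using hkq', by simpa using hq2, ⟨x, hx⟩, fun i => ?_, ?_⟩
      · have h1 : ((a i : ℝ) - q * x i) ^ 2 ≤ ψ q ^ 2 :=
          sq_le_sq.2 ((ha' i).le.trans (le_abs_self _))
        have h2 : (1 : ℝ) ≤ q := by exact_mod_cast hq1
        have h3 := hψpos q
        simp only [Int.cast_natCast]
        calc _ ≤ ψ q ^ 2 := h1
          _ ≤ ψ q * 1 := by nlinarith
          _ ≤ (1 + m * C) * ψ (2 ^ k) * q := by
            have h4 : ψ q ≤ (1 + m * C) * ψ (2 ^ k) := by nlinarith [hψpos (2 ^ k)]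
            have h5 := h3.le.trans h4
            gcongr
      · have h4 := abs_sum_mul_le (h.abs_y_le ⟨x, hx⟩) (fun i => (ha' i).le)
        simp only [Int.cast_natCast]
        calc _ ≤ ψ q + m * (C * ψ q) := (abs_sub _ _).trans (add_le_add hb'.le h4)
          _ = (1 + m * C) * ψ q := by ring
          _ ≤ _ := by gcongr
    · intro i
      simp only [Int.cast_natCast]
      refine (ha i).le.trans ?_
      have := hψpos (2 ^ k)
      gcongr
  have hψq : ψ q ≤ ψ 0 := hψdec (Nat.zero_le q)
  have hψ00 := hψpos 0
  have hNC : (N : ℝ) ≤ N * C := le_mul_of_one_le_right (by positivity) hC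
  have hqN' : (q : ℝ) ≤ N := by exact_mod_cast hqN.le
  have hbd : ∀ {v : ℝ} {c : ℤ}, |v| ≤ C → |(c : ℝ) - q * v| < ψ q → |(c : ℝ)| ≤ X := by
    intro v c hv hc
    have e : (c : ℝ) = (c - q * v) + q * v := by ring
    rw [e]
    refine (abs_add_le _ _).trans ?_
    rw [abs_mul, abs_of_pos hq0]
    have : q * |v| ≤ N * C := by gcongr
    linarith
  refine mem_intBox ?_ (fun i => hbd (h.abs_x_le ⟨x, hx⟩ i) (ha' i))
    (hbd (h.abs_u_le ⟨x, hx⟩) hb')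
  simp only [Int.cast_natCast, abs_of_pos hq0]
  linarith

lemma ediam_closedBox_le {m : ℕ} (c : Fin m → ℝ) {ρ : ℝ} (hρ : 0 ≤ ρ) :
    Metric.ediam {x : Fin m → ℝ | ∀ i, |x i - c i| ≤ ρ} ≤ ENNReal.ofReal (2 * ρ) := by
  have : {x : Fin m → ℝ | ∀ i, |x i - c i| ≤ ρ} ⊆ Metric.closedBall c ρ := fun x hx =>
    (dist_pi_le_iff hρ).2 fun i => hx i
  refine (Metric.ediam_mono this).trans ?_
  rw [← Metric.closedEBall_ofReal hρ]
  refine Metric.ediam_closedEBall_le.trans (le_of_eq ?_)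
  rw [ENNReal.ofReal_mul zero_le_two, ENNReal.ofReal_ofNat]

open Filter Topology in
lemma LegendrePair.hausdorffMeasure_eq_zero {m : ℕ} (hm : 2 ≤ m) {U : Set (Fin m → ℝ)}
    {f : (Fin m → ℝ) → ℝ} {y : (Fin m → ℝ) → Fin m → ℝ} {C : ℝ}
    (h : LegendrePair (fun t : U => t.1) (fun t : U => y t) (fun t : U => f t) C)
    {ψ : ℕ → ℝ} (hψpos : ∀ q, 0 < ψ q) (hψdec : Antitone ψ)
    {s : ℝ} (hs : (m : ℝ) / 2 < s) (hsm : s ≤ m)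
    (hsum : Summable fun q : ℕ => ψ (q + 1) ^ (s + 1) * ((q : ℝ) + 1) ^ (m - s))
    {E : Set (Fin m → ℝ)} (hEU : E ⊆ U)
    (hE : ∀ x ∈ E, {t : ℕ × (Fin m → ℤ) × ℤ | 1 ≤ t.1 ∧
      (∀ i, |x i - (t.2.1 i : ℝ) / (t.1 : ℝ)| < ψ t.1 / (t.1 : ℝ)) ∧
      |f x - (t.2.2 : ℝ) / (t.1 : ℝ)| < ψ t.1 / (t.1 : ℝ)}.Infinite) :
    μH[s] E = 0 := by
  have hC := h.one_le
  have hm2 : (2 : ℝ) ≤ m := by exact_mod_cast hm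
  have hs0 : 0 < s := by linarith
  have hψ0 := tendsto_zero_of_summable_rpow hψpos (by linarith : 0 < s + 1)
    (sub_nonneg.2 hsm) hsum
  obtain ⟨β, hβ, hcount⟩ := exists_countingBound U hm
    (β := (m + 1 - s) / (s + 1)) (by rw [div_lt_one (by linarith)]; linarith)
  rw [div_lt_iff₀ (by linarith)] at hβ
  obtain ⟨K, hK0, hK⟩ := hcount _ _ _ _ h
  set M : ℝ := 1 + m * C with hM
  have hM1 : 1 ≤ M := by
    have : 0 ≤ m * C := by positivity
    linarith
  set P : ℕ → Set (IntTriple m) := fun k => nearPoints (fun t : U => t.1) (fun t : U => y t)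
    (fun t : U => f t) (2 ^ k) (M * ψ (2 ^ k)) with hP
  have hpow : Tendsto (fun k : ℕ => 2 ^ k) atTop atTop :=
    tendsto_pow_atTop_atTop_of_one_lt one_lt_two
  have hMψ : Tendsto (fun k : ℕ => M * ψ (2 ^ k)) atTop (𝓝 0) := by
    simpa using (hψ0.comp hpow).const_mul M
  obtain ⟨k₁, hk₁⟩ := eventually_atTop.1 (hMψ.eventually (ge_mem_nhds one_pos))
  have h2k : ∀ k : ℕ, (1 : ℝ) ≤ 2 ^ k := fun k => one_le_pow₀ (by norm_num)
  have hfin : ∀ k, k₁ ≤ k → (P k).Finite := fun k hk => h.finite_nearPoints (h2k k) (hk₁ k hk)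
  classical
  set S : ℕ → Finset (IntTriple m) := fun k => if hk : k₁ ≤ k then (hfin k hk).toFinset else ∅
    with hS
  set r : ℕ → ℝ := fun k => 2 * (ψ (2 ^ k) / 2 ^ k) with hr
  have hr0 : ∀ k, 0 < r k := fun k => by have := hψpos (2 ^ k); positivity
  have hranti : Antitone r := fun j k hjk => by
    have h1 : ψ (2 ^ k) ≤ ψ (2 ^ j) := hψdec (Nat.pow_le_pow_right two_pos hjk)
    have := hψpos (2 ^ k)
    have := hψpos (2 ^ j)
    have h2 : (2 : ℝ) ^ j ≤ 2 ^ k := pow_le_pow_right₀ one_le_two hjk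
    simp only [hr]
    gcongr
  have hrt : Tendsto r atTop (𝓝 0) := by
    refine squeeze_zero (fun k => (hr0 k).le) (fun k => ?_)
      (by simpa using (hψ0.comp hpow).const_mul 2)
    simp only [hr]
    have := hψpos (2 ^ k)
    gcongr
    exact div_le_self this.le (h2k k)
  refine hausdorffMeasure_eq_zero_of_frequently hs0 S
    (fun k z => {x | ∀ i, |x i - (z.2.1 i : ℝ) / z.1| ≤ ψ (2 ^ k) / 2 ^ k})
    (fun k => (hr0 k).le) hranti hrt
    (fun k z => ediam_closedBox_le (fun i => (z.2.1 i : ℝ) / z.1)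
      (by have := hψpos (2 ^ k); positivity)) ?_ ?_
  · set A : ℕ → ℝ := fun k => ((2 : ℝ) ^ k) ^ (m - s + 1) * ψ (2 ^ k) ^ (s + 1) with hA
    have hAs : Summable A := summable_two_pow_mul_of_antitone (g := fun q => ψ q ^ (s + 1))
      (fun q => (Real.rpow_pos_of_pos (hψpos q) _).le)
      (fun j k hjk => Real.rpow_le_rpow (hψpos k).le (hψdec hjk) (by linarith))
      (sub_nonneg.2 hsm) hsum
    set B : ℕ → ℝ := fun k => ((2 : ℝ) ^ k) ^ (m - s + 1 - β * (s + 1)) with hB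
    have hBs : Summable B := by
      have := summable_geometric_of_lt_one
        (Real.rpow_nonneg zero_le_two (m - s + 1 - β * (s + 1)))
        (Real.rpow_lt_one_of_one_lt_of_neg one_lt_two (by linarith))
      refine this.congr fun k => ?_
      rw [hB, Real.rpow_pow_comm zero_le_two]
    refine Summable.of_nonneg_of_le (fun k => mul_nonneg (by positivity)
      (Real.rpow_pos_of_pos (hr0 k) _).le) (fun k => ?_)
      ((hAs.add hBs).mul_left (K * 2 ^ s * (M + 1)))
    have hψk := hψpos (2 ^ k)
    by_cases hk : k₁ ≤ k
    · have hcard : ((S k).card : ℝ) ≤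
          K * ((2 ^ k) ^ (m + 1) * (M * ψ (2 ^ k) + (2 ^ k) ^ (-β))) := by
        have := hK (2 ^ k) (M * ψ (2 ^ k)) (h2k k) (by positivity) (hk₁ k hk)
        rw [Set.ncard_eq_toFinset_card _ (hfin k hk)] at this
        simpa [hS, hk] using this
      have hrs : r k ^ s = 2 ^ s * (ψ (2 ^ k) ^ s * ((2 : ℝ) ^ k) ^ (-s)) := by
        rw [hr, Real.mul_rpow zero_le_two (by positivity), Real.div_rpow hψk.le (by positivity),
          Real.rpow_neg (by positivity), div_eq_mul_inv]
      have hb : 0 < ((2 : ℝ) ^ k) ^ (-β) := by positivity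
      have hprod := rpow_mul_le_add hψk hb hs0.le
      have hψs : 0 < ψ (2 ^ k) ^ s := Real.rpow_pos_of_pos hψk _
      have hexp : ((2 : ℝ) ^ k) ^ (m + 1) * ((2 : ℝ) ^ k) ^ (-s) =
          ((2 : ℝ) ^ k) ^ (m - s + 1) := by
        rw [← Real.rpow_natCast _ (m + 1), ← Real.rpow_add (by positivity)]
        push_cast; congr 1; ring
      have hBk : B k = ((2 : ℝ) ^ k) ^ (m - s + 1) * (((2 : ℝ) ^ k) ^ (-β)) ^ (s + 1) := by
        rw [hB, ← Real.rpow_mul (by positivity), ← Real.rpow_add (by positivity)]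
        ring_nf
      have hT0 : 0 < (((2 : ℝ) ^ k) ^ (-β)) ^ (s + 1) := by positivity
      calc _ ≤ K * ((2 ^ k) ^ (m + 1) * (M * ψ (2 ^ k) + (2 ^ k) ^ (-β))) *
            (2 ^ s * (ψ (2 ^ k) ^ s * ((2 : ℝ) ^ k) ^ (-s))) := by rw [hrs]; gcongr
        _ = K * 2 ^ s * (((2 : ℝ) ^ k) ^ (m + 1) * ((2 : ℝ) ^ k) ^ (-s)) *
            (M * (ψ (2 ^ k) ^ s * ψ (2 ^ k)) + ψ (2 ^ k) ^ s * (2 ^ k) ^ (-β)) := by ring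
        _ = K * 2 ^ s * ((2 : ℝ) ^ k) ^ (m - s + 1) *
            (M * ψ (2 ^ k) ^ (s + 1) + ψ (2 ^ k) ^ s * (2 ^ k) ^ (-β)) := by
            rw [hexp, Real.rpow_add_one hψk.ne']
        _ ≤ K * 2 ^ s * ((2 : ℝ) ^ k) ^ (m - s + 1) *
            ((M + 1) * (ψ (2 ^ k) ^ (s + 1) + (((2 : ℝ) ^ k) ^ (-β)) ^ (s + 1))) := by
            gcongr
            nlinarith
        _ = _ := by rw [hBk, hA]; ring
    · have hS0 : S k = ∅ := by simp [hS, hk]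
      rw [hS0, Finset.card_empty, Nat.cast_zero, zero_mul]
      have : 0 < A k := mul_pos (by positivity) (Real.rpow_pos_of_pos hψk _)
      have : 0 < B k := by positivity
      positivity
  · intro x hx
    refine ((h.frequently_mem_nearPoints hψpos hψdec hψ0 (hEU hx) (hE x hx)).and_eventually
      (eventually_ge_atTop k₁)).mono ?_
    rintro k ⟨⟨z, hz, hzx⟩, hk⟩
    refine ⟨z, ?_, hzx⟩
    simpa [hS, hk] using hz

/-- Near a point of nondegeneracy, a function and its gradient form a Legendre pair. -/
lemma exists_legendrePair_of_det_ne_zero {m : ℕ} {I : Set (Fin m → ℝ)} (hconv : Convex ℝ I)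
    (hcomp : IsCompact I) {f : (Fin m → ℝ) → ℝ} {G : (Fin m → ℝ) → (Fin m → ℝ) →L[ℝ] ℝ}
    {y : (Fin m → ℝ) → Fin m → ℝ} {L : (Fin m → ℝ) → (Fin m → ℝ) →L[ℝ] (Fin m → ℝ)}
    (hf : ∀ x ∈ I, HasFDerivWithinAt f (G x) I x)
    (hG : ∀ x v, G x v = ∑ i, y x i * v i)
    (hy : ∀ x ∈ I, HasFDerivWithinAt y (L x) I x) (hL : ContinuousOn L I) {p : Fin m → ℝ}
    (hp : p ∈ I) (hdet : (L p).det ≠ 0) :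
    ∃ ε > 0, ∃ C, LegendrePair (fun t : ↥(I ∩ Metric.ball p ε) => t.1)
      (fun t : ↥(I ∩ Metric.ball p ε) => y t) (fun t : ↥(I ∩ Metric.ball p ε) => f t) C := by
  set A := (L p).toContinuousLinearEquivOfDetNeZero hdet with hA
  have hAL : ∀ v, A v = L p v := fun v => by simp [hA]
  set N : ℝ := ‖(A.symm : (Fin m → ℝ) →L[ℝ] (Fin m → ℝ))‖ with hN
  have hN0 : 0 ≤ N := norm_nonneg _
  set c : ℝ := 1 / (2 * (N + 1)) with hc
  have hc0 : 0 < c := by positivity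
  have hNc : N * c ≤ 1 / 2 := by
    rw [hc, mul_one_div, div_le_div_iff₀ (by positivity) (by norm_num)]; linarith
  obtain ⟨ε, hε, hball⟩ := Metric.continuousWithinAt_iff.1 (hL p hp) c hc0
  set U := I ∩ Metric.ball p ε with hU
  have hUI : U ⊆ I := Set.inter_subset_left
  have hUconv : Convex ℝ U := hconv.inter (convex_ball p ε)
  obtain ⟨Bx, hBx⟩ := hcomp.exists_bound_of_continuousOn continuousOn_id
  obtain ⟨By, hBy⟩ := hcomp.exists_bound_of_continuousOn fun x hx => (hy x hx).continuousWithinAt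
  obtain ⟨Bf, hBf⟩ := hcomp.exists_bound_of_continuousOn fun x hx => (hf x hx).continuousWithinAt
  have hBx0 : 0 ≤ Bx := (norm_nonneg _).trans (hBx p hp)
  have hBy0 : 0 ≤ By := (norm_nonneg _).trans (hBy p hp)
  have hBf0 : 0 ≤ Bf := (norm_nonneg _).trans (hBf p hp)
  have happrox : ∀ s ∈ U, ∀ t ∈ U, ‖y s - y t - L p (s - t)‖ ≤ c * ‖s - t‖ := fun s hs t ht =>
    hUconv.norm_image_sub_le_of_norm_hasFDerivWithin_le'
      (fun x hx => (hy x (hUI hx)).mono hUI)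
      (fun x hx => by
        have := hball (hUI hx) hx.2
        rw [dist_eq_norm] at this
        exact this.le) ht hs
  set Λ : ℝ := ‖L p‖ + c with hΛ
  have hΛ0 : 0 ≤ Λ := by positivity
  have hlip : ∀ s ∈ U, ∀ t ∈ U, ‖y s - y t‖ ≤ Λ * ‖s - t‖ := fun s hs t ht => by
    have h1 := happrox s hs t ht
    have h2 := (L p).le_opNorm (s - t)
    have h3 := norm_add_le (y s - y t - L p (s - t)) (L p (s - t))
    rw [sub_add_cancel] at h3
    rw [hΛ, add_mul]; linarith
  have hanti : ∀ s ∈ U, ∀ t ∈ U, ‖s - t‖ ≤ 2 * N * ‖y s - y t‖ := fun s hs t ht => by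
    have h1 := happrox s hs t ht
    have h2 : ‖s - t‖ ≤ N * ‖L p (s - t)‖ := by
      have := (A.symm : (Fin m → ℝ) →L[ℝ] (Fin m → ℝ)).le_opNorm (A (s - t))
      rw [ContinuousLinearEquiv.coe_coe, A.symm_apply_apply, hAL] at this
      exact this
    have h3 := norm_sub_le (y s - y t) (y s - y t - L p (s - t))
    rw [sub_sub_cancel] at h3
    have h4 : N * ‖L p (s - t)‖ ≤ N * (‖y s - y t‖ + c * ‖s - t‖) := by gcongr; linarith
    nlinarith [norm_nonneg (s - t)]
  have hGlip : ∀ s t, ‖G s - G t‖ ≤ m * ‖y s - y t‖ := fun s t => by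
    refine ContinuousLinearMap.opNorm_le_bound _ (by positivity) fun v => ?_
    rw [sub_apply, hG, hG, ← Finset.sum_sub_distrib, Real.norm_eq_abs]
    simp_rw [← sub_mul]
    have := abs_sum_mul_le (fun i => norm_le_pi_norm (y s - y t) i) (norm_le_pi_norm v)
    rw [mul_assoc]
    exact this
  have htaylor : ∀ s ∈ U, ∀ t ∈ U,
      |f s - f t - ∑ i, y t i * (s i - t i)| ≤ m * Λ * ‖s - t‖ ^ 2 := fun s hs t ht => by
    have hseg : segment ℝ t s ⊆ U := hUconv.segment_subset ht hs
    have := (convex_segment t s).norm_image_sub_le_of_norm_hasFDerivWithin_le' (𝕜 := ℝ)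
      (f := f) (f' := G) (φ := G t) (C := m * (Λ * ‖s - t‖))
      (fun x hx => (hf x (hUI (hseg hx))).mono (hseg.trans hUI))
      (fun x hx => by
        refine (hGlip x t).trans ?_
        gcongr
        refine (hlip x (hseg hx) t ht).trans ?_
        gcongr
        exact norm_sub_le_of_mem_segment hx) (left_mem_segment ℝ t s) (right_mem_segment ℝ t s)
    rw [hG, Real.norm_eq_abs] at this
    refine this.trans (le_of_eq ?_)
    ring
  have hmΛ : 0 ≤ m * Λ := by positivity
  refine ⟨ε, hε, 1 + Bx + By + Bf + 2 * N + Λ + m * Λ, ⟨by linarith, fun t i => ?_,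
    fun t i => ?_, fun t => ?_, fun s t => ?_, fun s t => ?_, fun s t => ?_⟩⟩
  · exact ((norm_le_pi_norm t.1 i).trans (hBx _ (hUI t.2))).trans (by linarith)
  · exact ((norm_le_pi_norm (y t) i).trans (hBy _ (hUI t.2))).trans (by linarith)
  · exact (hBf _ (hUI t.2)).trans (by linarith)
  · exact (hanti s s.2 t t.2).trans (by gcongr; linarith)
  · exact (hlip s s.2 t t.2).trans (by gcongr; linarith)
  · exact (htaylor s s.2 t t.2).trans (by gcongr; linarith)

lemma uniqueDiffOn_Icc_pi (m : ℕ) : UniqueDiffOn ℝ (Set.Icc (0 : Fin m → ℝ) 1) := by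
  rw [← Set.pi_univ_Icc]
  exact UniqueDiffOn.univ_pi fun i => uniqueDiffOn_Icc zero_lt_one

lemma Icc_subset_closure_interior (m : ℕ) :
    Set.Icc (0 : Fin m → ℝ) 1 ⊆ closure (interior (Set.Icc 0 1)) := by
  rw [← Set.pi_univ_Icc, interior_pi_set Set.finite_univ, closure_pi_set]
  refine Set.pi_mono fun i _ => ?_
  simp

lemma fderivWithin_apply_eq_hess {m : ℕ} {f : (Fin m → ℝ) → ℝ} {I : Set (Fin m → ℝ)}
    (hf : ContDiffOn ℝ 2 f I) (hI : UniqueDiffOn ℝ I) {x : Fin m → ℝ} (hx : x ∈ interior I)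
    (i j : Fin m) :
    fderivWithin ℝ (fun z i => fderivWithin ℝ f I z (Pi.single i 1)) I x (Pi.single j 1) i =
      hess f x j i := by
  have hnhds : I ∈ nhds x := mem_interior_iff_mem_nhds.1 hx
  have hG : ContDiffOn ℝ 1 (fderivWithin ℝ f I) I := hf.fderivWithin hI (by norm_num)
  have hGx : DifferentiableAt ℝ (fderivWithin ℝ f I) x :=
    (hG.differentiableOn (by norm_num) x (interior_subset hx)).differentiableAt hnhds
  have hd : ∀ i : Fin m,
      DifferentiableAt ℝ (fun z => fderivWithin ℝ f I z (Pi.single i 1)) x :=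
    fun i => hGx.clm_apply (differentiableAt_const _)
  rw [fderivWithin_of_mem_nhds hnhds, fderiv_pi hd, hess, Matrix.of_apply]
  simp only [ContinuousLinearMap.coe_pi']
  congr 1
  refine Filter.EventuallyEq.fderiv_eq ?_
  filter_upwards [eventually_mem_nhds_iff.2 hnhds] with z hz
  rw [fderivWithin_of_mem_nhds hz]

lemma le_abs_det_fderivWithin {m : ℕ} {f : (Fin m → ℝ) → ℝ} {c : ℝ}
    (hf : ContDiffOn ℝ 2 f (Set.Icc 0 1))
    (hHess : ∀ x ∈ Set.Icc (0 : Fin m → ℝ) 1, c ≤ |(hess f x).det|) {x : Fin m → ℝ}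
    (hx : x ∈ Set.Icc (0 : Fin m → ℝ) 1)
    (hL : ContinuousOn (fderivWithin ℝ (fun z i => fderivWithin ℝ f (Set.Icc 0 1) z
      (Pi.single i 1)) (Set.Icc 0 1)) (Set.Icc (0 : Fin m → ℝ) 1)) :
    c ≤ |(fderivWithin ℝ (fun z (i : Fin m) => fderivWithin ℝ f (Set.Icc 0 1) z
      (Pi.single i 1)) (Set.Icc 0 1) x).det| := by
  refine ContinuousWithinAt.closure_le (Icc_subset_closure_interior m hx)
    continuousWithinAt_const
    ((ContinuousLinearMap.continuous_det.comp_continuousOn hL).abs x hx |>.mono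
      interior_subset) fun z hz => ?_
  refine (hHess z (interior_subset hz)).trans (le_of_eq ?_)
  congr 1
  have hdet : ∀ A : (Fin m → ℝ) →L[ℝ] (Fin m → ℝ), A.det =
      (LinearMap.toMatrix' (A : (Fin m → ℝ) →ₗ[ℝ] (Fin m → ℝ))).det :=
    fun A => (LinearMap.det_toMatrix' _).symm
  rw [Function.comp_apply, hdet, ← Matrix.det_transpose]
  congr 1
  ext i j
  rw [Matrix.transpose_apply, LinearMap.toMatrix'_apply, ContinuousLinearMap.coe_coe,
    fderivWithin_apply_eq_hess hf (uniqueDiffOn_Icc_pi m) hz]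

lemma exists_legendrePair_of_hess {m : ℕ} {f : (Fin m → ℝ) → ℝ} {c : ℝ} (hc : 0 < c)
    (hf : ContDiffOn ℝ 2 f (Set.Icc 0 1))
    (hHess : ∀ x ∈ Set.Icc (0 : Fin m → ℝ) 1, c ≤ |(hess f x).det|) {p : Fin m → ℝ}
    (hp : p ∈ Set.Icc (0 : Fin m → ℝ) 1) :
    ∃ ε > 0, ∃ y : (Fin m → ℝ) → Fin m → ℝ, ∃ C,
      LegendrePair (fun t : ↥(Set.Icc 0 1 ∩ Metric.ball p ε) => t.1)
        (fun t : ↥(Set.Icc 0 1 ∩ Metric.ball p ε) => y t)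
        (fun t : ↥(Set.Icc 0 1 ∩ Metric.ball p ε) => f t) C := by
  set I := Set.Icc (0 : Fin m → ℝ) 1 with hI
  have hu : UniqueDiffOn ℝ I := uniqueDiffOn_Icc_pi m
  set y : (Fin m → ℝ) → Fin m → ℝ := fun z i => fderivWithin ℝ f I z (Pi.single i 1) with hy
  have hG : ContDiffOn ℝ 1 (fderivWithin ℝ f I) I := hf.fderivWithin hu (by norm_num)
  have hyC : ContDiffOn ℝ 1 y I := contDiffOn_pi.2 fun i => hG.clm_apply contDiffOn_const
  have hL : ContinuousOn (fderivWithin ℝ y I) I :=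
    hyC.continuousOn_fderivWithin hu (by norm_num)
  have hdet := le_abs_det_fderivWithin hf hHess hp hL
  obtain ⟨ε, hε, C, h⟩ := exists_legendrePair_of_det_ne_zero (convex_Icc 0 1) isCompact_Icc
    (f := f) (G := fderivWithin ℝ f I) (y := y) (L := fderivWithin ℝ y I)
    (fun x hx => (hf.differentiableOn (by norm_num) x hx).hasFDerivWithinAt)
    (fun x v => by
      have h1 : v = ∑ i, v i • Pi.single i (1 : ℝ) := by
        ext j; simp [Finset.sum_apply, Pi.single_apply]
      conv_lhs => rw [h1]
      rw [map_sum]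
      refine Finset.sum_congr rfl fun i _ => ?_
      rw [map_smul, smul_eq_mul, mul_comm])
    (fun x hx => (hyC.differentiableOn (by norm_num) x hx).hasFDerivWithinAt) hL hp
    (abs_pos.1 (hc.trans_le hdet))
  exact ⟨ε, hε, y, C, h⟩

theorem statement6 (n : ℕ) (hn : 3 ≤ n) (l : ℕ)
    (hl : l = max ((n - 1) / 2 + 5) (n + 1))
    (f : (Fin (n - 1) → ℝ) → ℝ)
    (hf : ContDiffOn ℝ (l : ℕ∞) f (Set.Icc 0 1))
    (c₁ c₂ : ℝ) (hc₁ : 0 < c₁)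
    (hHess : ∀ x ∈ Set.Icc (0 : Fin (n - 1) → ℝ) 1,
      c₁ ≤ |(hess f x).det| ∧ |(hess f x).det| ≤ c₂)
    (ψ : ℕ → ℝ) (hψpos : ∀ q, 0 < ψ q) (hψdec : Antitone ψ)
    (s : ℝ) (hs : ((n : ℝ) - 1) / 2 < s)
    (hsum : Summable fun q : ℕ =>
      ψ (q + 1) ^ (s + 1) * ((q : ℝ) + 1) ^ ((n : ℝ) - 1 - s)) :
    μH[s] (Omega n f ψ) = 0 := by
  have hcast : ((n - 1 : ℕ) : ℝ) = (n : ℝ) - 1 := by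
    rw [Nat.cast_sub (by omega), Nat.cast_one]
  have hs0 : 0 < s := by
    have : (3 : ℝ) ≤ n := by exact_mod_cast hn
    linarith
  rcases lt_or_ge ((n - 1 : ℕ) : ℝ) s with hlt | hsm
  · lift s to NNReal using hs0.le
    refine hausdorffMeasure_of_dimH_lt ((dimH_mono (Set.subset_univ _)).trans_lt ?_)
    rw [Real.dimH_univ_pi, Fintype.card_fin]
    exact_mod_cast hlt
  have hf2 : ContDiffOn ℝ 2 f (Set.Icc 0 1) := hf.of_le (by
    have : (2 : ℕ∞) ≤ l := by
      have : 2 ≤ l := by omega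
      exact_mod_cast this
    exact WithTop.coe_le_coe.2 this)
  rw [← hcast] at hs hsum
  choose! ε hε y C hyC using fun p (hp : p ∈ Set.Icc (0 : Fin (n - 1) → ℝ) 1) =>
    exists_legendrePair_of_hess hc₁ hf2 (fun x hx => (hHess x hx).1) hp
  obtain ⟨t, htI, ht⟩ := isCompact_Icc.elim_nhds_subcover (fun p => Metric.ball p (ε p))
    fun p hp => Metric.ball_mem_nhds p (hε p hp)
  refine measure_mono_null (t := ⋃ p ∈ t, Omega n f ψ ∩ Metric.ball p (ε p)) (fun x hx => ?_)
    ((measure_biUnion_null_iff t.countable_toSet).2 fun p hp => ?_)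
  · obtain ⟨p, hp, hxp⟩ := Set.mem_iUnion₂.1 (ht hx.1)
    exact Set.mem_iUnion₂.2 ⟨p, hp, hx, hxp⟩
  · exact (hyC p (htI p hp)).hausdorffMeasure_eq_zero (by omega) hψpos hψdec hs hsm hsum
      (fun x hx => ⟨hx.1.1, hx.2⟩) fun x hx => hx.1.2
end

section
/- Let n ≥ 3, let V ⊆ ℝ^{n-1} be a bounded open set, g : V → [0,∞) a bounded function, and f* a real-valued function defined on a neighborhood of V̄. Suppose that for all M ≥ 1 and T ≥ 1: Σ_{t ≤ T, s ∈ ℤ^{n-1} with s/t ∈ V, ‖t f*(s/t)‖ < M^{-1}} g(s/t) ≤ A(M^{-1}T^n + T^{β*}) for some β* ≥ n−1 and A > 0. Then for all M ≥ 2 and T ≥ 1: (i) Σ_{t ≤ T, s/t ∈ V, ‖t f*(s/t)‖ < M^{-1}} g(s/t) t^{-(n-1)/2} ≤ 2A(M^{-1}T^{(n+1)/2} + T^{β* − (n-1)/2}), and (ii) Σ_{t ≤ T, s/t ∈ V, ‖t f*(s/t)‖ ≥ M^{-1}} g(s/t) t^{-(n-1)/2} ‖t f*(s/t)‖^{-1}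 ≤ 6A(T^{(n+1)/2} log M + T^{β* − (n-1)/2} M). -/
open MeasureTheory Real

/-- Distance from a real number to the nearest integer. -/
noncomputable def nint (θ : ℝ) : ℝ := |θ - round θ|

/-- Partial summation against `x ^ (-a)`: the weights `w i` sit at the points `τ i ∈ [1, T]`. -/
theorem sum_mul_rpow_neg_le {ι : Type*} (I : Finset ι) (w τ : ι → ℝ) {T a p q C D : ℝ}
    (ha : 0 < a) (hp : 2 * a ≤ p) (hq : 2 * a ≤ q) (hC : 0 ≤ C) (hD : 0 ≤ D) (hT : 1 ≤ T)
    (hw : ∀ i ∈ I, 0 ≤ w i) (hτ : ∀ i ∈ I, 1 ≤ τ i) (hτT : ∀ i ∈ I, τ i ≤ T)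
    (h : ∀ x, 1 ≤ x → x ≤ T → ∑ i ∈ I with τ i ≤ x, w i ≤ C * x ^ p + D * x ^ q) :
    ∑ i ∈ I, w i * τ i ^ (-a) ≤ 2 * (C * T ^ (p - a) + D * T ^ (q - a)) := by
  have hT0 : 0 < T := by linarith
  have hint : ∀ r : ℝ, IntervalIntegrable (fun x : ℝ => x ^ r) volume 1 T := fun r =>
    intervalIntegral.intervalIntegrable_rpow (Or.inr (by
      rw [Set.uIcc_of_le hT]; intro h0; linarith [h0.1]))
  have hker : IntegrableOn (fun x : ℝ => a * x ^ (-a - 1)) (Set.Ioc 1 T) :=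
    ((intervalIntegrable_iff_integrableOn_Ioc_of_le hT).1 (hint (-a - 1))).const_mul a
  have hpt : ∀ i ∈ I, τ i ^ (-a) = T ^ (-a) +
      ∫ x in Set.Ioc 1 T, (Set.Ioi (τ i)).indicator (fun x : ℝ => a * x ^ (-a - 1)) x := by
    intro i hi
    have h1 := hτ i hi
    have h2 := hτT i hi
    rw [setIntegral_indicator measurableSet_Ioi,
      show Set.Ioc 1 T ∩ Set.Ioi (τ i) = Set.Ioc (τ i) T by
        ext x; simp only [Set.mem_inter_iff, Set.mem_Ioc, Set.mem_Ioi]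
        exact ⟨fun h => ⟨h.2, h.1.2⟩, fun h => ⟨⟨by linarith [h.1], h.2⟩, h.1⟩⟩,
      ← intervalIntegral.integral_of_le h2, intervalIntegral.integral_const_mul,
      integral_rpow (Or.inr ⟨by linarith, by
        rw [Set.uIcc_of_le h2]; intro h0; linarith [h0.1]⟩)]
    rw [show -a - 1 + 1 = -a by ring]
    field_simp
    ring
  have hind : ∀ i ∈ I, IntegrableOn (fun x => w i *
      (Set.Ioi (τ i)).indicator (fun x : ℝ => a * x ^ (-a - 1)) x) (Set.Ioc 1 T) := fun i _ =>
    (hker.indicator measurableSet_Ioi).const_mul _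
  have hbd : ∫ x in Set.Ioc 1 T, ∑ i ∈ I, w i *
        (Set.Ioi (τ i)).indicator (fun x : ℝ => a * x ^ (-a - 1)) x ≤
      ∫ x in Set.Ioc 1 T, (a * C * x ^ (p - a - 1) + a * D * x ^ (q - a - 1)) := by
    refine setIntegral_mono_on (integrable_finsetSum _ hind) ?_ measurableSet_Ioc ?_
    · exact (((intervalIntegrable_iff_integrableOn_Ioc_of_le hT).1 (hint _)).const_mul _).add
        (((intervalIntegrable_iff_integrableOn_Ioc_of_le hT).1 (hint _)).const_mul _)
    · intro x hx
      have hx0 : 0 < x := by linarith [hx.1]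
      calc ∑ i ∈ I, w i * (Set.Ioi (τ i)).indicator (fun x : ℝ => a * x ^ (-a - 1)) x
          ≤ ∑ i ∈ I, (if τ i ≤ x then w i else 0) * (a * x ^ (-a - 1)) := by
            refine Finset.sum_le_sum fun i hi => ?_
            have := hw i hi
            by_cases h1 : τ i < x
            · simp [Set.indicator, h1, h1.le]
            · simp only [Set.indicator, Set.mem_Ioi, h1, if_false, mul_zero]
              split_ifs <;> positivity
        _ = (∑ i ∈ I with τ i ≤ x, w i) * (a * x ^ (-a - 1)) := by
            rw [← Finset.sum_mul, Finset.sum_filter]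
        _ ≤ (C * x ^ p + D * x ^ q) * (a * x ^ (-a - 1)) :=
            mul_le_mul_of_nonneg_right (h x hx.1.le hx.2) (by positivity)
        _ = a * C * x ^ (p - a - 1) + a * D * x ^ (q - a - 1) := by
            rw [show p - a - 1 = p + (-a - 1) by ring, show q - a - 1 = q + (-a - 1) by ring,
              rpow_add hx0, rpow_add hx0]
            ring
  have hpow : ∀ {r : ℝ}, 2 * a ≤ r → a * ∫ x in (1 : ℝ)..T, x ^ (r - a - 1) ≤ T ^ (r - a) := by
    intro r hr
    rw [integral_rpow (Or.inl (by linarith)), sub_add_cancel, one_rpow, ← mul_div_assoc,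
      div_le_iff₀ (by linarith)]
    have : 0 < T ^ (r - a) := by positivity
    nlinarith
  have hval : ∫ x in Set.Ioc 1 T, (a * C * x ^ (p - a - 1) + a * D * x ^ (q - a - 1)) ≤
      C * T ^ (p - a) + D * T ^ (q - a) := by
    rw [← intervalIntegral.integral_of_le hT, intervalIntegral.integral_add
      ((hint _).const_mul _) ((hint _).const_mul _), intervalIntegral.integral_const_mul,
      intervalIntegral.integral_const_mul]
    have h1 := mul_le_mul_of_nonneg_left (hpow hp) hC
    have h2 := mul_le_mul_of_nonneg_left (hpow hq) hD
    linarith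
  have hend : (∑ i ∈ I, w i) * T ^ (-a) ≤ C * T ^ (p - a) + D * T ^ (q - a) := by
    have := h T hT le_rfl
    rw [Finset.filter_true_of_mem hτT] at this
    calc _ ≤ (C * T ^ p + D * T ^ q) * T ^ (-a) :=
          mul_le_mul_of_nonneg_right this (by positivity)
      _ = _ := by
        rw [sub_eq_add_neg, sub_eq_add_neg, rpow_add hT0, rpow_add hT0]
        ring
  calc ∑ i ∈ I, w i * τ i ^ (-a)
      = (∑ i ∈ I, w i) * T ^ (-a) + ∫ x in Set.Ioc 1 T, ∑ i ∈ I, w i *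
        (Set.Ioi (τ i)).indicator (fun x : ℝ => a * x ^ (-a - 1)) x := by
        rw [integral_finsetSum _ hind, Finset.sum_mul, ← Finset.sum_add_distrib]
        refine Finset.sum_congr rfl fun i hi => ?_
        rw [integral_const_mul, hpt i hi, mul_add]
    _ ≤ 2 * (C * T ^ (p - a) + D * T ^ (q - a)) := by linarith

/-- Layer-cake bound for a sum of reciprocals `(ν i)⁻¹` with `M⁻¹ ≤ ν i ≤ 1`. -/
theorem sum_mul_inv_le {ι : Type*} (I : Finset ι) (v ν : ι → ℝ) {M C D : ℝ} (hM : 1 ≤ M)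
    (hv : ∀ i ∈ I, 0 ≤ v i) (hν : ∀ i ∈ I, ν i < 1)
    (h : ∀ u, 1 ≤ u → u ≤ M → ∑ i ∈ I with ν i < u⁻¹, v i ≤ C * u⁻¹ + D) :
    ∑ i ∈ I with M⁻¹ ≤ ν i, v i * (ν i)⁻¹ ≤ C * (1 + log M) + D * M := by
  have hM0 : 0 < M := by linarith
  set J := I.filter (fun i => M⁻¹ ≤ ν i) with hJ
  have hJI : ∀ i ∈ J, i ∈ I := fun i hi => (Finset.mem_filter.1 hi).1
  have hJM : ∀ i ∈ J, M⁻¹ ≤ ν i := fun i hi => (Finset.mem_filter.1 hi).2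
  have hJ0 : ∀ i ∈ J, 0 < ν i := fun i hi => (inv_pos.2 hM0).trans_le (hJM i hi)
  have hsub : ∀ u, 1 ≤ u → u ≤ M → ∑ i ∈ J with ν i < u⁻¹, v i ≤ C * u⁻¹ + D := by
    refine fun u h1 h2 => (Finset.sum_le_sum_of_subset_of_nonneg ?_ ?_).trans (h u h1 h2)
    · exact Finset.filter_subset_filter _ (Finset.filter_subset _ _)
    · exact fun i hi _ => hv i (Finset.mem_filter.1 hi).1
  have hpt : ∀ i ∈ J, (ν i)⁻¹ = 1 +
      ∫ u in Set.Ioc 1 M, (Set.Iio (ν i)⁻¹).indicator (fun _ : ℝ => (1 : ℝ)) u := by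
    intro i hi
    have h1 : 1 ≤ (ν i)⁻¹ := (one_le_inv₀ (hJ0 i hi)).2 (hν i (hJI i hi)).le
    have h2 : (ν i)⁻¹ ≤ M := inv_le_of_inv_le₀ hM0 (hJM i hi)
    rw [setIntegral_indicator measurableSet_Iio,
      show Set.Ioc 1 M ∩ Set.Iio (ν i)⁻¹ = Set.Ioo 1 (ν i)⁻¹ by
        ext x; simp only [Set.mem_inter_iff, Set.mem_Ioc, Set.mem_Iio, Set.mem_Ioo]
        exact ⟨fun h => ⟨h.1.1, h.2⟩, fun h => ⟨⟨h.1, by linarith [h.2]⟩, h.2⟩⟩]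
    simp [h1]
  have hind : ∀ i ∈ J, IntegrableOn (fun u => v i *
      (Set.Iio (ν i)⁻¹).indicator (fun _ : ℝ => (1 : ℝ)) u) (Set.Ioc 1 M) := fun i _ =>
    ((integrable_const (1 : ℝ)).indicator measurableSet_Iio).const_mul _
  have hinv : IntervalIntegrable (fun u : ℝ => u⁻¹) volume 1 M :=
    intervalIntegrable_inv_iff.2 (Or.inr (by
      rw [Set.uIcc_of_le hM]; intro h0; linarith [h0.1]))
  have hbd : ∫ u in Set.Ioc 1 M, ∑ i ∈ J, v i *
        (Set.Iio (ν i)⁻¹).indicator (fun _ : ℝ => (1 : ℝ)) u ≤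
      ∫ u in Set.Ioc 1 M, (C * u⁻¹ + D) := by
    refine setIntegral_mono_on (integrable_finsetSum _ hind) ?_ measurableSet_Ioc ?_
    · exact (((intervalIntegrable_iff_integrableOn_Ioc_of_le hM).1 hinv).const_mul _).add
        (integrableOn_const (by simp))
    · intro u hu
      have hu0 : 0 < u := by linarith [hu.1]
      refine le_of_eq_of_le ?_ (hsub u hu.1.le hu.2)
      rw [Finset.sum_filter (s := J)]
      refine Finset.sum_congr rfl fun i hi => ?_
      simp [Set.indicator, lt_inv_comm₀ hu0 (hJ0 i hi)]
  have hval : ∫ u in Set.Ioc 1 M, (C * u⁻¹ + D) = C * log M + D * (M - 1) := by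
    rw [← intervalIntegral.integral_of_le hM, intervalIntegral.integral_add
      (hinv.const_mul _) intervalIntegrable_const, intervalIntegral.integral_const_mul,
      integral_inv_of_pos one_pos hM0]
    simp [mul_comm]
  have hend : ∑ i ∈ J, v i ≤ C + D := by
    have := hsub 1 le_rfl hM
    rwa [Finset.filter_true_of_mem (by simpa using fun i hi => hν i (hJI i hi)), inv_one,
      mul_one] at this
  calc ∑ i ∈ J, v i * (ν i)⁻¹
      = ∑ i ∈ J, v i + ∫ u in Set.Ioc 1 M, ∑ i ∈ J, v i *
        (Set.Iio (ν i)⁻¹).indicator (fun _ : ℝ => (1 : ℝ)) u := by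
        rw [integral_finsetSum _ hind, ← Finset.sum_add_distrib]
        refine Finset.sum_congr rfl fun i hi => ?_
        rw [integral_const_mul]
        conv_lhs => rw [hpt i hi]
        rw [mul_add, mul_one]
    _ ≤ C * (1 + log M) + D * M := by linarith

theorem finsum_finsum_eq_sum {α β R : Type*} [AddCommMonoid R] (I : Finset (α × β))
    (h : α → β → R) (hI : ∀ a b, (a, b) ∉ I → h a b = 0) :
    ∑ᶠ (a : α) (b : β), h a b = ∑ p ∈ I, h p.1 p.2 := by
  have hs : Function.support (fun p : α × β => h p.1 p.2) ⊆ I := fun p hp => by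
    by_contra hn
    exact hp (hI p.1 p.2 hn)
  rw [← finsum_eq_sum_of_support_subset _ hs, finsum_curry _ (I.finite_toSet.subset hs)]

/-- A bounded set contains only finitely many rational points of bounded denominator. -/
theorem finite_rational_points {ι : Type*} [Fintype ι] {V : Set (ι → ℝ)}
    (hV : Bornology.IsBounded V) (T : ℝ) :
    {p : ℕ × (ι → ℤ) | 1 ≤ p.1 ∧ (p.1 : ℝ) ≤ T ∧
      (fun i => (p.2 i : ℝ) / (p.1 : ℝ)) ∈ V}.Finite := by
  classical
  obtain ⟨R, hR⟩ := hV.exists_norm_le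
  refine ((Set.finite_Icc 1 ⌊T⌋₊).prod (Set.finite_Icc (fun _ : ι => -⌈R * T⌉)
    (fun _ => ⌈R * T⌉))).subset ?_
  rintro ⟨t, s⟩ ⟨h1, h2, h3⟩
  have ht : (0 : ℝ) < t := by exact_mod_cast h1
  have hR0 : 0 ≤ R := (norm_nonneg _).trans (hR _ h3)
  have hs : ∀ i, |(s i : ℝ)| ≤ ⌈R * T⌉ := fun i => by
    have := (norm_le_pi_norm _ i).trans (hR _ h3)
    rw [Real.norm_eq_abs, abs_div, abs_of_pos ht, div_le_iff₀ ht] at this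
    exact this.trans ((mul_le_mul_of_nonneg_left h2 hR0).trans (Int.le_ceil _))
  refine ⟨⟨h1, Nat.le_floor h2⟩, fun i => ?_, fun i => ?_⟩
  · exact_mod_cast (abs_le.1 (hs i)).1
  · exact_mod_cast (abs_le.1 (hs i)).2

open scoped Classical in
theorem statement9 (n : ℕ) (hn : 3 ≤ n)
    (V : Set (Fin (n - 1) → ℝ)) (hVopen : IsOpen V) (hVbdd : Bornology.IsBounded V)
    (g : (Fin (n - 1) → ℝ) → ℝ) (hg0 : ∀ x, 0 ≤ g x) (hgbdd : ∃ B, ∀ x, g x ≤ B)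
    (fstar : (Fin (n - 1) → ℝ) → ℝ)
    (A βs : ℝ) (hA : 0 < A) (hβs : (n : ℝ) - 1 ≤ βs)
    (H : ∀ M T : ℝ, 1 ≤ M → 1 ≤ T →
      (∑ᶠ (t : ℕ) (s : Fin (n - 1) → ℤ),
        if 1 ≤ t ∧ (t : ℝ) ≤ T ∧ (fun i => (s i : ℝ) / (t : ℝ)) ∈ V ∧
            nint ((t : ℝ) * fstar (fun i => (s i : ℝ) / (t : ℝ))) < M⁻¹
          then g (fun i => (s i : ℝ) / (t : ℝ)) else 0)
        ≤ A * (M⁻¹ * T ^ n + T ^ βs)) :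
    ∀ M T : ℝ, 2 ≤ M → 1 ≤ T →
      ((∑ᶠ (t : ℕ) (s : Fin (n - 1) → ℤ),
        if 1 ≤ t ∧ (t : ℝ) ≤ T ∧ (fun i => (s i : ℝ) / (t : ℝ)) ∈ V ∧
            nint ((t : ℝ) * fstar (fun i => (s i : ℝ) / (t : ℝ))) < M⁻¹
          then g (fun i => (s i : ℝ) / (t : ℝ)) * (t : ℝ) ^ (-((n : ℝ) - 1) / 2) else 0)
        ≤ 2 * A * (M⁻¹ * T ^ (((n : ℝ) + 1) / 2) + T ^ (βs - ((n : ℝ) - 1) / 2))) ∧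
      ((∑ᶠ (t : ℕ) (s : Fin (n - 1) → ℤ),
        if 1 ≤ t ∧ (t : ℝ) ≤ T ∧ (fun i => (s i : ℝ) / (t : ℝ)) ∈ V ∧
            M⁻¹ ≤ nint ((t : ℝ) * fstar (fun i => (s i : ℝ) / (t : ℝ)))
          then g (fun i => (s i : ℝ) / (t : ℝ)) * (t : ℝ) ^ (-((n : ℝ) - 1) / 2) *
            (nint ((t : ℝ) * fstar (fun i => (s i : ℝ) / (t : ℝ))))⁻¹ else 0)
        ≤ 6 * A * (T ^ (((n : ℝ) + 1) / 2) * Real.log M + T ^ (βs - ((n : ℝ) - 1) / 2) * M)) := by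
  have hn' : (3 : ℝ) ≤ n := by exact_mod_cast hn
  intro M T hM hT
  have hfin := finite_rational_points hVbdd T
  set I := hfin.toFinset with hI
  have hmem : ∀ t s, (t, s) ∈ I ↔ 1 ≤ t ∧ (t : ℝ) ≤ T ∧
      (fun i => (s i : ℝ) / (t : ℝ)) ∈ V := fun t s => by simp [hI]
  let w : ℕ × (Fin (n - 1) → ℤ) → ℝ := fun p => g (fun i => (p.2 i : ℝ) / (p.1 : ℝ))
  let ν : ℕ × (Fin (n - 1) → ℤ) → ℝ := fun p =>
    nint ((p.1 : ℝ) * fstar (fun i => (p.2 i : ℝ) / (p.1 : ℝ)))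
  have hw : ∀ p, 0 ≤ w p := fun p => hg0 _
  have hν : ∀ p, ν p < 1 := fun p => (abs_sub_round _).trans_lt (by norm_num)
  have hτ : ∀ p ∈ I, (1 : ℝ) ≤ (p.1 : ℝ) := fun p hp => by
    exact_mod_cast ((hmem p.1 p.2).1 hp).1
  have hτT : ∀ p ∈ I, (p.1 : ℝ) ≤ T := fun p hp => ((hmem p.1 p.2).1 hp).2.1
  have hweighted : ∀ u : ℝ, 1 ≤ u →
      ∑ p ∈ I with ν p < u⁻¹, w p * (p.1 : ℝ) ^ (-(((n : ℝ) - 1) / 2)) ≤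
        2 * (A * u⁻¹ * T ^ ((n : ℝ) - ((n : ℝ) - 1) / 2) +
          A * T ^ (βs - ((n : ℝ) - 1) / 2)) := by
    intro u hu
    refine sum_mul_rpow_neg_le _ w (fun p => (p.1 : ℝ)) (by linarith) (by linarith)
      (by linarith) (by positivity) hA.le hT (fun p _ => hw p)
      (fun p hp => hτ p (Finset.mem_filter.1 hp).1)
      (fun p hp => hτT p (Finset.mem_filter.1 hp).1) ?_
    intro x hx hxT
    have hH := H u x hu hx
    rw [finsum_finsum_eq_sum I _ (fun t s hts => if_neg fun hc =>
      hts ((hmem t s).2 ⟨hc.1, hc.2.1.trans hxT, hc.2.2.1⟩))] at hH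
    rw [Finset.filter_filter, Finset.sum_filter, rpow_natCast]
    refine le_of_eq_of_le (Finset.sum_congr rfl fun p hp => ?_) (hH.trans_eq (by ring))
    have := (hmem p.1 p.2).1 hp
    exact if_congr ⟨fun hc => ⟨this.1, hc.2, this.2.2, hc.1⟩, fun hc => ⟨hc.2.2.2, hc.2.1⟩⟩ rfl rfl
  rw [show (n : ℝ) - ((n : ℝ) - 1) / 2 = ((n : ℝ) + 1) / 2 by ring] at hweighted
  rw [show -((n : ℝ) - 1) / 2 = -(((n : ℝ) - 1) / 2) by ring]
  constructor
  · rw [finsum_finsum_eq_sum I _ (fun t s hts => if_neg fun hc =>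
      hts ((hmem t s).2 ⟨hc.1, hc.2.1, hc.2.2.1⟩))]
    refine le_of_eq_of_le ?_ ((hweighted M (by linarith)).trans_eq (by ring))
    rw [Finset.sum_filter]
    refine Finset.sum_congr rfl fun p hp => ?_
    have := (hmem p.1 p.2).1 hp
    exact if_congr ⟨fun hc => hc.2.2.2, fun hc => ⟨this.1, this.2.1, this.2.2, hc⟩⟩ rfl rfl
  · rw [finsum_finsum_eq_sum I _ (fun t s hts => if_neg fun hc =>
      hts ((hmem t s).2 ⟨hc.1, hc.2.1, hc.2.2.1⟩))]
    have hsum := sum_mul_inv_le I (fun p => w p * (p.1 : ℝ) ^ (-(((n : ℝ) - 1) / 2))) ν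
      (C := 2 * A * T ^ (((n : ℝ) + 1) / 2)) (D := 2 * A * T ^ (βs - ((n : ℝ) - 1) / 2))
      (show 1 ≤ M by linarith) (fun p _ => mul_nonneg (hw p) (by positivity)) (fun p _ => hν p)
      (fun u hu _ => (hweighted u hu).trans_eq (by ring))
    have hlog : 1 ≤ 2 * log M := by
      have := log_le_log (by norm_num) hM
      linarith [log_two_gt_d9]
    have hP : 0 ≤ 2 * A * T ^ (((n : ℝ) + 1) / 2) := by positivity
    have hQ : 0 ≤ A * T ^ (βs - ((n : ℝ) - 1) / 2) * M := by positivity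
    have hPlog := mul_le_mul_of_nonneg_left hlog hP
    refine le_of_eq_of_le ?_ (hsum.trans (by linarith))
    rw [Finset.sum_filter]
    refine Finset.sum_congr rfl fun p hp => ?_
    have := (hmem p.1 p.2).1 hp
    exact if_congr ⟨fun hc => hc.2.2.2, fun hc => ⟨this.1, this.2.1, this.2.2, hc⟩⟩ rfl rfl
end
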